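/- arXiv:2212.02380 — 3 statements merged into one kernel-verified Lean document; each statement's English description precedes it below -/
import Mathlib

section
/- Let S = (D, −, Σ, Σ₀, (D_a)_{a∈Σ}) be a signature such that at least one graph over S exists, |D| ≥ 2, and D_a is non-empty for every a ∈ Σ. Let r = |D|/2, m = |Σ|, and k = max_{a∈Σ} |D_a|. Then there exists a graph over S with at most 2·m·r·min{r^r, k^{2r−2}} nodes. -/
/-- A signature `S = (D, −, Σ, Σ₀, (D_a)_{a∈Σ})`: a finite set `D` of directions with an
involution `neg`, a finite set `Lab` of node labels, a set `init ⊆ Lab` of initial labels,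
and for each label `a` a set `Da a ⊆ D` of directions used at nodes labelled `a`. -/
structure Signature where
  D : Type
  [fintypeD : Fintype D]
  [decEqD : DecidableEq D]
  neg : D → D
  neg_neg : ∀ d, neg (neg d) = d
  Lab : Type
  [fintypeLab : Fintype Lab]
  [decEqLab : DecidableEq Lab]
  init : Finset Lab
  Da : Lab → Finset D

attribute [instance] Signature.fintypeD Signature.decEqD Signature.fintypeLab Signature.decEqLab

/-- A (finite) graph over a signature `S`: nodes are `Fin n`, `v0` is the initial node,
`edge` is the partial function `+ : V × D ⇀ V`, and `lab` the labelling. -/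
structure SigGraph (S : Signature) where
  n : ℕ
  v0 : Fin n
  edge : Fin n → S.D → Option (Fin n)
  lab : Fin n → S.Lab
  edge_sym : ∀ v d u, edge v d = some u → edge u (S.neg d) = some v
  edge_dom : ∀ v d, (edge v d).isSome ↔ d ∈ S.Da (lab v)
  init_iff : ∀ v, lab v ∈ S.init ↔ v = v0

/-- The neighbour of `v` in direction `d` (defined whenever `d ∈ D_{λ(v)}`). -/
def SigGraph.nbr {S : Signature} (G : SigGraph S) (v : Fin G.n) (d : S.D)
    (h : d ∈ S.Da (G.lab v)) : Fin G.n :=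
  (G.edge v d).get ((G.edge_dom v d).mpr h)

/-- The number of nodes of `G` labelled with `a`. -/
def SigGraph.numLab {S : Signature} (G : SigGraph S) (a : S.Lab) : ℕ :=
  (Finset.univ.filter fun v : Fin G.n => G.lab v = a).card

/-- Two graphs (over possibly different signatures) have the same set of nodes, the same
initial node and the same edge structure (each pair of nodes is connected by the same
number of edges); only node labels and direction labels may differ. -/
def SameSkeleton {S S' : Signature} (G : SigGraph S) (G' : SigGraph S') : Prop :=
  ∃ h : G.n = G'.n,
    ((G.v0 : ℕ) = (G'.v0 : ℕ)) ∧
    ∀ u w : Fin G.n,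
      (Finset.univ.filter fun d : S.D => G.edge u d = some w).card
        = (Finset.univ.filter fun d' : S'.D =>
            G'.edge (Fin.cast h u) d' = some (Fin.cast h w)).card

/-- A star automaton over `S`: a finite set of states `Q` and a finite set `T` of stars.
A star `(a, q, q₁, …, q_{|D_a|})` is encoded as a label `a`, a centre state `q`, and the
assignment `d ↦ q_d` of states to the rays, one for each direction `d ∈ D_a`. -/
structure StarAutomaton (S : Signature) where
  Q : Type
  [fintypeQ : Fintype Q]
  [decEqQ : DecidableEq Q]
  T : Finset (Σ a : S.Lab, Q × ({d // d ∈ S.Da a} → Q))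

attribute [instance] StarAutomaton.fintypeQ StarAutomaton.decEqQ

/-- A computation of a star automaton on a graph: a choice of states in all nodes such that
the star around every node belongs to `T`. -/
def StarAutomaton.IsComputation {S : Signature} (A : StarAutomaton S) (G : SigGraph S)
    (q : Fin G.n → A.Q) : Prop :=
  ∀ v : Fin G.n,
    (⟨G.lab v, (q v, fun d : {d // d ∈ S.Da (G.lab v)} => q (G.nbr v d.1 d.2))⟩ :
        Σ a : S.Lab, A.Q × ({d // d ∈ S.Da a} → A.Q)) ∈ A.T

/-- A star automaton accepts a graph if it has at least one computation on it. -/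
def StarAutomaton.Accepts {S : Signature} (A : StarAutomaton S) (G : SigGraph S) : Prop :=
  ∃ q : Fin G.n → A.Q, A.IsComputation G q

/-- A deterministic graph-walking automaton over `S`. -/
structure GWA (S : Signature) where
  Q : Type
  [fintypeQ : Fintype Q]
  [decEqQ : DecidableEq Q]
  q0 : Q
  F : Finset (Q × S.Lab)
  δ : Q × S.Lab → Option (Q × S.D)
  δ_not_F : ∀ q a p, δ (q, a) = some p → (q, a) ∉ F
  δ_dir : ∀ q a p, δ (q, a) = some p → p.2 ∈ S.Da a

attribute [instance] GWA.fintypeQ GWA.decEqQ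

/-- One step of a graph-walking automaton on a graph, as a relation on configurations. -/
def GWA.Step {S : Signature} (A : GWA S) (G : SigGraph S)
    (c c' : A.Q × Fin G.n) : Prop :=
  ∃ (q' : A.Q) (d : S.D) (h : d ∈ S.Da (G.lab c.2)),
    A.δ (c.1, G.lab c.2) = some (q', d) ∧ c' = (q', G.nbr c.2 d h)

/-- A graph-walking automaton accepts a graph if its (unique) computation from the initial
configuration reaches an accepting configuration. -/
def GWA.Accepts {S : Signature} (A : GWA S) (G : SigGraph S) : Prop :=
  ∃ c : A.Q × Fin G.n,
    Relation.ReflTransGen (A.Step G) (A.q0, G.v0) c ∧ (c.1, G.lab c.2) ∈ A.F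



lemma det_abs_le {n : Type*} [Fintype n] [DecidableEq n] (M : Matrix n n ℤ) (κ : ℤ)
    (h : ∀ j, ∑ i, |M i j| ≤ κ) : |M.det| ≤ κ ^ Fintype.card n := by
  classical
  calc |M.det| ≤ ∑ σ : Equiv.Perm n, ∏ j, |M (σ j) j| := by
        rw [Matrix.det_apply]
        refine (Finset.abs_sum_le_sum_abs _ _).trans (Finset.sum_le_sum fun σ _ => ?_)
        rw [← Finset.abs_prod]
        rcases Int.units_eq_one_or (Equiv.Perm.sign σ) with hs | hs <;> simp [hs]
    _ ≤ ∑ f : n → n, ∏ j, |M (f j) j| := by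
        rw [← Finset.sum_image (s := (Finset.univ : Finset (Equiv.Perm n)))
          (g := fun σ : Equiv.Perm n => (σ : n → n)) (f := fun f : n → n => ∏ j, |M (f j) j|)
          (fun a _ b _ hab => DFunLike.coe_injective hab)]
        exact Finset.sum_le_sum_of_subset_of_nonneg (Finset.subset_univ _)
          (fun f _ _ => Finset.prod_nonneg fun j _ => abs_nonneg _)
    _ = ∏ j, ∑ i, |M i j| := by
        rw [Finset.prod_univ_sum]; simp
    _ ≤ ∏ j : n, κ := Finset.prod_le_prod (fun j _ => Finset.sum_nonneg fun _ _ => abs_nonneg _)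
        (fun j _ => h j)
    _ = _ := by simp

lemma exists_rows {ι J : Type} [Fintype ι] [Fintype J] [DecidableEq J] (C : Matrix ι J ℚ)
    (h : LinearIndependent ℚ C.col) :
    ∃ f : J → ι, Function.Injective f ∧ (C.submatrix f id).det ≠ 0 := by
  classical
  have h1 : C.rank = Fintype.card J := by
    rw [← Matrix.rank_transpose]
    exact LinearIndependent.rank_matrix (M := C.transpose) h
  rw [Matrix.rank_eq_finrank_span_row] at h1
  obtain ⟨K, a, ha, hs, hl⟩ := exists_linearIndependent' ℚ C.row
  have : Fintype K := Fintype.ofInjective a ha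
  have h2 : Fintype.card K = Fintype.card J := by
    rw [← h1, ← hs]; exact (finrank_span_eq_card hl).symm
  let e : J ≃ K := (Fintype.equivOfCardEq h2).symm
  refine ⟨a ∘ e, ha.comp e.injective, ?_⟩
  have h3 : LinearIndependent ℚ (C.submatrix (a ∘ e) id).row := hl.comp e e.injective
  rw [Matrix.linearIndependent_rows_iff_isUnit, Matrix.isUnit_iff_isUnit_det] at h3
  exact h3.ne_zero

/-- ratio-test reduction -/
lemma ratio {L : Type} [Fintype L] (x u : L → ℚ) (hx : ∀ a, 0 ≤ x a)
    (hpos : ∃ a, 0 < u a) :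
    ∃ t : ℚ, 0 ≤ t ∧ (∀ a, 0 ≤ x a - t * u a) ∧ ∃ a, 0 < u a ∧ x a - t * u a = 0 := by
  classical
  obtain ⟨b, hb, hmin⟩ := Finset.exists_min_image (Finset.univ.filter fun a => 0 < u a)
    (fun a => x a / u a) (by obtain ⟨a, ha⟩ := hpos; exact ⟨a, by simpa using ha⟩)
  have hb' : 0 < u b := by simpa using hb
  have ht : 0 ≤ x b / u b := div_nonneg (hx b) hb'.le
  refine ⟨x b / u b, ht, fun a => ?_, b, hb', ?_⟩
  · by_cases ha : 0 < u a
    · have := hmin a (by simpa using ha)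
      rw [le_div_iff₀ ha] at this
      linarith
    · have : x b / u b * u a ≤ 0 := mul_nonpos_of_nonneg_of_nonpos ht (not_lt.1 ha)
      linarith [hx a]
  · field_simp; ring

lemma cramer_step {ι L : Type} [Fintype ι] [Fintype L] [DecidableEq L]
    (A : Matrix ι L ℤ) (κ : ℤ) (hκ : 1 ≤ κ) (hcol : ∀ a, ∑ i, |A i a| ≤ κ)
    (x : L → ℚ) (hx : ∀ a, 0 ≤ x a) (hA : ∀ i, ∑ a, (A i a : ℚ) * x a = 0)
    (j0 : L) (hj0 : x j0 ≠ 0)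
    (hli : LinearIndependent ℚ
      (Matrix.of fun (i : ι) (j : {j // x j ≠ 0 ∧ j ≠ j0}) => (A i j.1 : ℚ)).col) :
    ∃ v : L → ℤ, (∀ a, 0 ≤ v a) ∧ v ≠ 0 ∧ (∀ i, ∑ a, A i a * v a = 0) ∧
      (∀ a, v a ≠ 0 → x a ≠ 0) ∧ ∑ a, v a ≤ (Fintype.card ι + 1) * κ ^ Fintype.card ι := by
  classical
  obtain ⟨f, hf, hdet⟩ := exists_rows _ hli
  let C : Matrix {j // x j ≠ 0 ∧ j ≠ j0} {j // x j ≠ 0 ∧ j ≠ j0} ℤ := Matrix.of fun i j => A (f i) j.1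
  let b   : {j // x j ≠ 0 ∧ j ≠ j0} → ℤ := fun i => A (f i) j0
  have hC : C.map (Int.cast : ℤ → ℚ) = (Matrix.of fun (i : ι) (j   : {j // x j ≠ 0 ∧ j ≠ j0}) => (A i j.1 : ℚ)).submatrix f id := by
    ext i j; simp [C]
  have hdetC : ((C.det : ℤ) : ℚ) = (C.map (Int.cast : ℤ → ℚ)).det := by
    simpa using (RingHom.map_det (Int.castRingHom ℚ) C)
  have hdC : C.det ≠ 0 := by
    intro h0; apply hdet; rw [← hC, ← hdetC, h0]; simp
  have hcardJ : Fintype.card {j // x j ≠ 0 ∧ j ≠ j0} ≤ Fintype.card ι := Fintype.card_le_of_injective f hf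
  have hpow : κ ^ Fintype.card {j // x j ≠ 0 ∧ j ≠ j0} ≤ κ ^ Fintype.card ι := pow_le_pow_right₀ hκ hcardJ
  have hsub : ∀ a, ∑ i   : {j // x j ≠ 0 ∧ j ≠ j0}, |A (f i) a| ≤ κ := fun a => by
    refine le_trans ?_ (hcol a)
    rw [← Finset.sum_image (s := Finset.univ) (g := f) (f := fun i => |A i a|)
      (fun a _ b _ hab => hf hab)]
    exact Finset.sum_le_sum_of_subset_of_nonneg (Finset.subset_univ _) (fun _ _ _ => abs_nonneg _)
  have hbC : |C.det| ≤ κ ^ Fintype.card ι := (det_abs_le C κ fun j => hsub j.1).trans hpow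
  have hbcr : ∀ j, |C.cramer b j| ≤ κ ^ Fintype.card ι := fun j => by
    rw [Matrix.cramer_apply]
    refine (det_abs_le _ κ fun j' => ?_).trans hpow
    by_cases h : j' = j
    · subst h; simpa [b] using hsub j0
    · simpa [Matrix.updateCol_ne h, C] using hsub j'.1
  have hxj0 : 0 < x j0 := lt_of_le_of_ne (hx _) (Ne.symm hj0)
  -- Cramer rule
  let y   : {j // x j ≠ 0 ∧ j ≠ j0} → ℚ := fun j => x j.1
  have hCy : (C.map (Int.cast : ℤ → ℚ)).mulVec y = fun i => -(x j0) * (b i : ℚ) := by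
    ext i
    have h := hA (f i)
    rw [← Finset.add_sum_erase _ _ (Finset.mem_univ j0)] at h
    have h2 : ∑ a ∈ Finset.univ.erase j0, (A (f i) a : ℚ) * x a
        = ∑ j   : {j // x j ≠ 0 ∧ j ≠ j0}, (A (f i) j.1 : ℚ) * x j.1 := by
      rw [← Finset.sum_subtype (Finset.univ.filter fun j => x j ≠ 0 ∧ j ≠ j0) (by simp)
        (fun a => (A (f i) a : ℚ) * x a)]
      symm
      apply Finset.sum_subset
      · intro a; simp
      · intro a ha hb
        have ha' : a ≠ j0 := by simpa using ha
        have : x a = 0 := by by_contra h; exact hb (by simp [h, ha'])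
        simp [this]
    simp only [Matrix.mulVec, dotProduct, Matrix.map_apply, C, y, b, Matrix.of_apply]
    linarith
  have key : ∀ j   : {j // x j ≠ 0 ∧ j ≠ j0}, (C.det : ℚ) * x j.1 = -(x j0) * (C.cramer b j : ℚ) := fun j => by
    have h1 := congrArg (fun w => (C.map (Int.cast : ℤ → ℚ)).adjugate.mulVec w j) hCy
    simp only [Matrix.mulVec_mulVec, Matrix.adjugate_mul, ← hdetC] at h1
    rw [Matrix.smul_mulVec, Matrix.one_mulVec] at h1
    have h3 : (C.cramer b j : ℚ) = ((C.map (Int.cast : ℤ → ℚ)).adjugate.mulVec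
        (fun i => (b i : ℚ))) j := by
      rw [Matrix.cramer_eq_adjugate_mulVec]
      have : (C.map (Int.cast : ℤ → ℚ)).adjugate = C.adjugate.map (Int.cast : ℤ → ℚ) := by
        simpa using (RingHom.map_adjugate (Int.castRingHom ℚ) C).symm
      rw [this]
      simp [Matrix.mulVec, dotProduct]
    rw [h3]
    have h4 : (fun i => -(x j0) * (b i : ℚ)) = (-(x j0)) • (fun i => (b i : ℚ)) := by
      ext; simp
    rw [h4, Matrix.mulVec_smul] at h1
    simpa [y] using h1
  let v : L → ℤ := fun a => if a = j0 then |C.det| else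
    if h : x a ≠ 0 ∧ a ≠ j0 then |C.cramer b ⟨a, h⟩| else 0
  have hv : ∀ a, (v a : ℚ) = |(C.det : ℚ)| / x j0 * x a := fun a => by
    simp only [v]
    split_ifs with h1 h2
    · subst h1; rw [Int.cast_abs]; field_simp
    · have := congrArg abs (key ⟨a, h2⟩)
      rw [abs_mul, abs_mul, abs_neg, abs_of_pos hxj0, abs_of_nonneg (hx a)] at this
      rw [Int.cast_abs]
      field_simp
      linarith
    · have : x a = 0 := by by_contra h; exact h2 ⟨h, h1⟩
      simp [this]
  have hvb : ∀ a, v a ≤ κ ^ Fintype.card ι := fun a => by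
    simp only [v]
    split_ifs
    · exact hbC
    · exact hbcr _
    · positivity
  refine ⟨v, fun a => ?_, fun h => ?_, fun i => ?_, fun a ha h => ha ?_, ?_⟩
  · simp only [v]; split_ifs <;> positivity
  · have := congrFun h j0
    simp [v] at this
    exact hdC this
  · have : ((∑ a, A i a * v a : ℤ) : ℚ) = 0 := by
      push_cast
      simp_rw [hv]
      calc _ = |(C.det : ℚ)| / x j0 * ∑ a, (A i a : ℚ) * x a := by
            rw [Finset.mul_sum]; exact Finset.sum_congr rfl fun a _ => by ring
        _ = 0 := by rw [hA]; simp
    exact_mod_cast this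
  · have := hv a
    rw [h] at this; simpa using this
  · have hs : ∑ a, v a = ∑ a ∈ insert j0 (Finset.univ.filter fun j => x j ≠ 0 ∧ j ≠ j0), v a := by
      symm
      apply Finset.sum_subset (Finset.subset_univ _)
      intro a _ ha
      simp only [Finset.mem_insert, Finset.mem_filter, Finset.mem_univ, true_and, not_or] at ha
      simp only [v]
      rw [if_neg ha.1, dif_neg ha.2]
    rw [hs]
    refine (Finset.sum_le_card_nsmul _ _ _ fun a _ => hvb a).trans ?_
    rw [nsmul_eq_mul]
    refine mul_le_mul_of_nonneg_right ?_ (by positivity)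
    have h1 := Finset.card_insert_le j0 (Finset.univ.filter fun j => x j ≠ 0 ∧ j ≠ j0)
    rw [← Fintype.card_subtype] at h1
    exact_mod_cast h1.trans (Nat.add_le_add_right hcardJ 1)

lemma elementary {ι L : Type} [Fintype ι] [Fintype L] [DecidableEq L]
    (A : Matrix ι L ℤ) (κ : ℤ) (hκ : 1 ≤ κ) (hcol : ∀ a, ∑ i, |A i a| ≤ κ) (s : ℕ) :
    ∀ (x : L → ℚ), (Finset.univ.filter fun a => x a ≠ 0).card ≤ s →
    (∀ a, 0 ≤ x a) → (∀ i, ∑ a, (A i a : ℚ) * x a = 0) → x ≠ 0 →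
    ∃ v : L → ℤ, (∀ a, 0 ≤ v a) ∧ v ≠ 0 ∧ (∀ i, ∑ a, A i a * v a = 0) ∧
      (∀ a, v a ≠ 0 → x a ≠ 0) ∧ ∑ a, v a ≤ (Fintype.card ι + 1) * κ ^ Fintype.card ι := by
  classical
  induction s with
  | zero =>
    intro x hs _ _ h0
    exfalso; apply h0; ext a
    by_contra h
    have : a ∈ Finset.univ.filter fun a => x a ≠ 0 := by simpa using h
    simp only [Nat.le_zero, Finset.card_eq_zero] at hs
    rw [hs] at this; simp at this
  | succ s ih =>
    intro x hs hx hA h0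
    obtain ⟨j0, hj0⟩ : ∃ j, x j ≠ 0 := by
      by_contra h; push Not at h; exact h0 (funext h)
    by_cases hli : LinearIndependent ℚ
      (Matrix.of fun (i : ι) (j : {j // x j ≠ 0 ∧ j ≠ j0}) => (A i j.1 : ℚ)).col
    · exact cramer_step A κ hκ hcol x hx hA j0 hj0 hli
    rw [Fintype.not_linearIndependent_iff] at hli
    obtain ⟨g, hg, j1, hj1⟩ := hli
    -- extend g
    obtain ⟨u, hu1, hu2, hu3⟩ : ∃ u : L → ℚ, (∀ a, u a ≠ 0 → x a ≠ 0 ∧ a ≠ j0) ∧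
        (∀ i, ∑ a, (A i a : ℚ) * u a = 0) ∧ ∃ a, 0 < u a := by
      let w : L → ℚ := fun a => if h : x a ≠ 0 ∧ a ≠ j0 then g ⟨a, h⟩ else 0
      have hw1 : ∀ a, w a ≠ 0 → x a ≠ 0 ∧ a ≠ j0 := fun a ha => by
        by_contra h; exact ha (by simp only [w]; rw [dif_neg h])
      have hw2 : ∀ i, ∑ a, (A i a : ℚ) * w a = 0 := fun i => by
        have h1 := congrFun hg i
        simp only [Finset.sum_apply, Pi.smul_apply, Matrix.col_apply, Matrix.of_apply,
          smul_eq_mul, Pi.zero_apply] at h1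
        rw [← h1]
        have h2 : ∑ a, (A i a : ℚ) * w a =
            ∑ a ∈ Finset.univ.filter (fun j => x j ≠ 0 ∧ j ≠ j0), (A i a : ℚ) * w a := by
          symm
          apply Finset.sum_subset (Finset.subset_univ _)
          intro a _ ha
          have : w a = 0 := by
            by_contra h; exact ha (by simpa using hw1 a h)
          simp [this]
        rw [h2, Finset.sum_subtype _ (p := fun j => x j ≠ 0 ∧ j ≠ j0) (by simp)]
        refine Finset.sum_congr rfl fun j _ => ?_
        have : w j.1 = g j := by simp only [w]; rw [dif_pos j.2]
        rw [this]; ring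
      have hw3 : w j1.1 ≠ 0 := by
        have : w j1.1 = g j1 := by simp only [w]; rw [dif_pos j1.2]
        rwa [this]
      rcases lt_or_gt_of_ne hw3 with h | h
      · refine ⟨fun a => - w a, fun a ha => hw1 a (by simpa using ha), fun i => ?_, j1.1, by simpa using h⟩
        simp [hw2]
      · exact ⟨w, hw1, hw2, j1.1, h⟩
    obtain ⟨t, ht, hnn, b, hb, hb0⟩ := ratio x u hx hu3
    have hsupp : ∀ a, x a - t * u a ≠ 0 → x a ≠ 0 := fun a ha h => by
      have : u a = 0 := by by_contra h'; exact (hu1 a h').1 h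
      exact ha (by simp [h, this])
    obtain ⟨v, hv1, hv2, hv3, hv4, hv5⟩ := ih (fun a => x a - t * u a) (by
      have : (Finset.univ.filter fun a => x a - t * u a ≠ 0) ⊂
          (Finset.univ.filter fun a => x a ≠ 0) := by
        rw [Finset.ssubset_iff_of_subset (by intro a ha; simp at ha ⊢; exact hsupp a ha)]
        exact ⟨b, by simpa using (hu1 b hb.ne').1, by simp [hb0]⟩
      have := Finset.card_lt_card this
      omega) hnn (fun i => by
        simp only [mul_sub, Finset.sum_sub_distrib, hA]
        have : ∑ a, (A i a : ℚ) * (t * u a) = t * ∑ a, (A i a : ℚ) * u a := by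
          rw [Finset.mul_sum]; exact Finset.sum_congr rfl fun a _ => by ring
        rw [this, hu2]; simp) (fun h => by
        have h := congrFun h j0
        have : u j0 = 0 := by by_contra h'; exact (hu1 j0 h').2 rfl
        simp [this] at h
        exact hj0 h)
    exact ⟨v, hv1, hv2, hv3, fun a ha => hsupp a (hv4 a ha), hv5⟩

lemma sum_bound {ι L : Type} [Fintype ι] [Fintype L] [DecidableEq L]
    (A : Matrix ι L ℤ) (κ : ℤ) (hκ : 1 ≤ κ) (hcol : ∀ a, ∑ i, |A i a| ≤ κ) (I : Finset L) (s : ℕ) :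
    ∀ (x : L → ℚ), (Finset.univ.filter fun a => x a ≠ 0).card ≤ s →
    (∀ a, 0 ≤ x a) → (∀ i, ∑ a, (A i a : ℚ) * x a = 0) → ∑ a ∈ I, x a ≤ 1 →
    (∀ v : L → ℤ, (∀ a, 0 ≤ v a) → v ≠ 0 → (∀ i, ∑ a, A i a * v a = 0) →
      ∑ a ∈ I, v a = 0 → ¬ ∀ a, (v a : ℚ) ≤ x a) →
    ∑ a, x a ≤ s * ((Fintype.card ι + 1) * κ ^ Fintype.card ι) := by
  classical
  induction s with
  | zero =>
    intro x hs _ _ _ _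
    have h0 : ∀ a, x a = 0 := fun a => by
      by_contra h
      have : a ∈ Finset.univ.filter fun a => x a ≠ 0 := by simpa using h
      simp only [Nat.le_zero, Finset.card_eq_zero] at hs
      rw [hs] at this; simp at this
    simp [h0]
  | succ s ih =>
    intro x hs hx hA hI hmin
    have hκ' : (1 : ℚ) ≤ κ := by exact_mod_cast hκ
    by_cases h0 : x = 0
    · subst h0; simp; positivity
    obtain ⟨v, hv1, hv2, hv3, hv4, hv5⟩ := elementary A κ hκ hcol _ x le_rfl hx hA h0
    have hvq : ∀ a, (0 : ℚ) ≤ v a := fun a => by exact_mod_cast hv1 a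
    obtain ⟨c, hc, hnn, b, hb, hb0⟩ := ratio x (fun a => (v a : ℚ)) hx (by
      by_contra h
      push Not at h
      apply hv2; ext a
      have := le_antisymm (h a) (hvq a)
      exact_mod_cast this)
    have hc1 : c ≤ 1 := by
      by_contra hc'
      push Not at hc'
      by_cases hz : ∑ a ∈ I, v a = 0
      · refine hmin v hv1 hv2 hv3 hz fun a => ?_
        have := hnn a
        nlinarith [hvq a]
      · have h1 : (1 : ℤ) ≤ ∑ a ∈ I, v a := by
          have : 0 ≤ ∑ a ∈ I, v a := Finset.sum_nonneg fun a _ => hv1 a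
          omega
        have h1' : (1 : ℚ) ≤ ∑ a ∈ I, (v a : ℚ) := by exact_mod_cast h1
        have h2 : 0 ≤ ∑ a ∈ I, (x a - c * v a) := Finset.sum_nonneg fun a _ => hnn a
        rw [Finset.sum_sub_distrib, ← Finset.mul_sum] at h2
        nlinarith
    have hle : ∀ a, x a - c * v a ≤ x a := fun a => by
      have := mul_nonneg hc (hvq a); linarith
    have hsupp : ∀ a, x a - c * v a ≠ 0 → x a ≠ 0 := fun a ha h => by
      have : v a = 0 := by by_contra h'; exact hv4 a h' h
      exact ha (by simp [h, this])
    have := ih (fun a => x a - c * v a) (by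
      have : (Finset.univ.filter fun a => x a - c * v a ≠ 0) ⊂
          (Finset.univ.filter fun a => x a ≠ 0) := by
        rw [Finset.ssubset_iff_of_subset (by intro a ha; simp at ha ⊢; exact hsupp a ha)]
        exact ⟨b, by simpa using hv4 b (by rintro h; simp [h] at hb), by simp [hb0]⟩
      have := Finset.card_lt_card this
      omega) hnn (fun i => by
        simp only [mul_sub, Finset.sum_sub_distrib, hA]
        have : ∑ a, (A i a : ℚ) * (c * v a) = c * ((∑ a, A i a * v a : ℤ) : ℚ) := by
          push_cast
          rw [Finset.mul_sum]; exact Finset.sum_congr rfl fun a _ => by ring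
        rw [this, hv3]; simp) ((Finset.sum_le_sum fun a _ => hle a).trans hI)
        (fun w h1 h2 h3 h4 h5 => hmin w h1 h2 h3 h4 fun a => (h5 a).trans (hle a))
    rw [Finset.sum_sub_distrib, ← Finset.mul_sum] at this
    have h6 : (∑ a, (v a : ℚ)) ≤ (Fintype.card ι + 1) * κ ^ Fintype.card ι := by exact_mod_cast hv5
    have h7 : 0 ≤ ∑ a, (v a : ℚ) := Finset.sum_nonneg fun a _ => hvq a
    push_cast
    nlinarith

/-- `x` is a valid label count. -/
def SigBalanced (S : Signature) (x : S.Lab → ℕ) : Prop :=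
  (∀ d, ∑ a with d ∈ S.Da a, x a = ∑ a with S.neg d ∈ S.Da a, x a) ∧ ∑ a ∈ S.init, x a = 1

lemma card_lab {L : Type} [Fintype L] [DecidableEq L] {n : ℕ} (lab : Fin n → L) (x : L → ℕ)
    (hx : ∀ a, (Finset.univ.filter fun v => lab v = a).card = x a) (s : Finset L) :
    (Finset.univ.filter fun v => lab v ∈ s).card = ∑ a ∈ s, x a := by
  rw [Finset.card_eq_sum_card_fiberwise (f := lab) (t := s) (fun v hv => by simpa using hv)]
  refine Finset.sum_congr rfl fun a ha => ?_
  rw [← hx a]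
  congr 1
  ext v
  simp only [Finset.mem_filter, Finset.mem_univ, true_and]
  constructor
  · exact fun h => h.2
  · exact fun h => ⟨h ▸ ha, h⟩

lemma SigGraph.balanced {S : Signature} (G : SigGraph S) : SigBalanced S G.numLab := by
  classical
  constructor
  · have key : ∀ d, ∑ a with d ∈ S.Da a, G.numLab a ≤ ∑ a with S.neg d ∈ S.Da a, G.numLab a := by
      intro d
      rw [← card_lab G.lab G.numLab (fun _ => rfl), ← card_lab G.lab G.numLab (fun _ => rfl)]
      simp only [Finset.mem_filter, Finset.mem_univ, true_and]
      have hd : ∀ v, d ∈ S.Da (G.lab v) → ∃ u, G.edge v d = some u := fun v hv =>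
        Option.isSome_iff_exists.1 ((G.edge_dom v d).2 hv)
      choose! f hf using hd
      apply Finset.card_le_card_of_injOn f
      · intro v hv
        have hv : d ∈ S.Da (G.lab v) := by simpa using hv
        have := G.edge_sym _ _ _ (hf v hv)
        simp [← G.edge_dom, this]
      · intro v hv w hw h
        have hv : d ∈ S.Da (G.lab v) := by simpa using hv
        have hw : d ∈ S.Da (G.lab w) := by simpa using hw
        have h1 := G.edge_sym _ _ _ (hf v hv)
        have h2 := G.edge_sym _ _ _ (hf w hw)
        rw [h] at h1
        exact Option.some_injective _ (h1.symm.trans h2)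
    intro d
    apply le_antisymm (key d)
    simpa [S.neg_neg] using key (S.neg d)
  · rw [← card_lab G.lab G.numLab (fun _ => rfl)]
    simp [G.init_iff, Finset.filter_eq']

lemma exists_transfer (V : Type) [Fintype V] [DecidableEq V] :
    ∃ g : Finset V → Finset V → V → V, ∀ s t, s.card = t.card → ∀ v ∈ s,
      g s t v ∈ t ∧ g t s (g s t v) = v := by
  refine ⟨fun s t v => if h : s.card = t.card ∧ v ∈ s then
    (t.equivFin.symm (Fin.cast h.1 (s.equivFin ⟨v, h.2⟩))).1 else v, fun s t h v hv => ?_⟩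
  have h1 : (if h : s.card = t.card ∧ v ∈ s then
    (t.equivFin.symm (Fin.cast h.1 (s.equivFin ⟨v, h.2⟩))).1 else v) =
    (t.equivFin.symm (Fin.cast h (s.equivFin ⟨v, hv⟩))).1 := dif_pos ⟨h, hv⟩
  simp only [h1]
  refine ⟨Subtype.property _, ?_⟩
  rw [dif_pos ⟨h.symm, Subtype.property _⟩]
  simp

lemma exists_labelling {L : Type} [Fintype L] [DecidableEq L] (x : L → ℕ) :
    ∃ lab : Fin (∑ a, x a) → L, ∀ a, (Finset.univ.filter fun v => lab v = a).card = x a := by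
  let e : Fin (∑ a, x a) ≃ (Σ a : L, Fin (x a)) :=
    (Fintype.equivFinOfCardEq (by simp)).symm
  refine ⟨fun v => (e v).1, fun a => ?_⟩
  have : (Finset.univ.filter fun v => (e v).1 = a) =
      (Finset.univ.image fun i : Fin (x a) => e.symm ⟨a, i⟩) := by
    ext v
    simp only [Finset.mem_filter, Finset.mem_univ, true_and, Finset.mem_image]
    constructor
    · rintro rfl; exact ⟨(e v).2, by simp⟩
    · rintro ⟨i, rfl⟩; simp
  rw [this, Finset.card_image_of_injective _ (fun i j h => by simpa using h)]
  simp

lemma SigBalanced.exists_graph {S : Signature} {x : S.Lab → ℕ} (h : SigBalanced S x) :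
    ∃ G : SigGraph S, G.n = ∑ a, x a := by
  classical
  obtain ⟨lab, hlab⟩ := exists_labelling x
  obtain ⟨g, hg⟩ := exists_transfer (Fin (∑ a, x a))
  have hinit := card_lab lab x hlab S.init
  rw [h.2, Finset.card_eq_one] at hinit
  obtain ⟨v0, hv0⟩ := hinit
  let V : S.D → Finset (Fin (∑ a, x a)) := fun d => Finset.univ.filter fun v => d ∈ S.Da (lab v)
  have hV : ∀ d, (V d).card = (V (S.neg d)).card := fun d => by
    have h1 := card_lab lab x hlab (Finset.univ.filter fun a => d ∈ S.Da a)
    have h2 := card_lab lab x hlab (Finset.univ.filter fun a => S.neg d ∈ S.Da a)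
    simp only [Finset.mem_filter, Finset.mem_univ, true_and] at h1 h2
    rw [h1, h2, h.1]
  have hmem : ∀ v d, v ∈ V d ↔ d ∈ S.Da (lab v) := fun v d => by simp [V]
  refine ⟨⟨∑ a, x a, v0, fun v d => if d ∈ S.Da (lab v) then some (g (V d) (V (S.neg d)) v) else none,
    lab, ?_, ?_, ?_⟩, rfl⟩
  · intro v d u huv
    by_cases hd : d ∈ S.Da (lab v)
    · rw [if_pos hd, Option.some_inj] at huv
      obtain ⟨h1, h2⟩ := hg (V d) (V (S.neg d)) (hV d) v ((hmem v d).2 hd)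
      rw [huv] at h1 h2
      rw [if_pos ((hmem _ _).1 h1), S.neg_neg, h2]
    · simp [hd] at huv
  · intro v d
    split_ifs with hd <;> simp [hd]
  · intro v
    have : v ∈ (Finset.univ.filter fun v => lab v ∈ S.init) ↔ v ∈ ({v0} : Finset _) := by rw [hv0]
    simpa using this

lemma exists_reps (S : Signature) : ∃ P : Finset S.D, Disjoint P (P.image S.neg) ∧
    ∀ d, d ∈ P ∨ S.neg d ∈ P ∨ S.neg d = d := by
  classical
  let e := Fintype.equivFin S.D
  refine ⟨Finset.univ.filter fun d => e d < e (S.neg d), ?_, fun d => ?_⟩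
  · rw [Finset.disjoint_left]
    intro d hd hd'
    simp only [Finset.mem_filter, Finset.mem_univ, true_and, Finset.mem_image] at hd hd'
    obtain ⟨d', h1, rfl⟩ := hd'
    rw [S.neg_neg] at hd
    exact lt_asymm h1 hd
  · simp only [Finset.mem_filter, Finset.mem_univ, true_and, S.neg_neg]
    rcases lt_trichotomy (e d) (e (S.neg d)) with h | h | h
    · exact Or.inl h
    · exact Or.inr (Or.inr (e.injective h).symm)
    · exact Or.inr (Or.inl h)

/-- The balance matrix. -/
def balMat (S : Signature) (P : Finset S.D) : Matrix P S.Lab ℤ := Matrix.of fun d a =>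
  (if d.1 ∈ S.Da a then 1 else 0) - (if S.neg d.1 ∈ S.Da a then 1 else 0)

lemma balMat_col (S : Signature) (P : Finset S.D) (hP : Disjoint P (P.image S.neg)) (a : S.Lab) :
    ∑ i, |balMat S P i a| ≤ min (P.card : ℤ) (S.Da a).card := by
  classical
  have hinj : Function.Injective S.neg := fun a b h => by rw [← S.neg_neg a, h, S.neg_neg]
  apply le_min
  · refine (Finset.sum_le_card_nsmul _ _ 1 fun d _ => ?_).trans (by simp)
    simp only [balMat, Matrix.of_apply]
    split_ifs <;> simp
  · calc ∑ i, |balMat S P i a| ≤ ∑ d : P, ((if d.1 ∈ S.Da a then 1 else 0) +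
          (if S.neg d.1 ∈ S.Da a then 1 else 0)) := by
          refine Finset.sum_le_sum fun d _ => ?_
          simp only [balMat, Matrix.of_apply]
          split_ifs <;> simp
      _ = ∑ d ∈ P, (if d ∈ S.Da a then (1 : ℤ) else 0) +
          ∑ d ∈ P.image S.neg, (if d ∈ S.Da a then (1 : ℤ) else 0) := by
          rw [Finset.sum_image (fun a _ b _ h => hinj h), ← Finset.sum_add_distrib,
            ← Finset.sum_coe_sort P]
      _ = ∑ d ∈ P ∪ P.image S.neg, (if d ∈ S.Da a then (1 : ℤ) else 0) := by
          rw [Finset.sum_union hP]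
      _ ≤ ∑ d, (if d ∈ S.Da a then (1 : ℤ) else 0) :=
          Finset.sum_le_sum_of_subset_of_nonneg (Finset.subset_univ _)
            (fun _ _ _ => by split_ifs <;> simp)
      _ = _ := by simp

lemma balMat_mul (S : Signature) (P : Finset S.D) (x : S.Lab → ℤ) (d : P) :
    ∑ a, balMat S P d a * x a =
      ∑ a with d.1 ∈ S.Da a, x a - ∑ a with S.neg d.1 ∈ S.Da a, x a := by
  simp only [balMat, Matrix.of_apply, sub_mul, Finset.sum_sub_distrib, Finset.sum_filter]
  simp

lemma main_bound (S : Signature) (hne : Nonempty (SigGraph S)) :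
    ∃ (G : SigGraph S) (p : ℕ), 2 * p ≤ Fintype.card S.D ∧
      G.n ≤ Fintype.card S.Lab * ((p + 1) *
        (max 1 (min p (Finset.univ.sup fun a : S.Lab => (S.Da a).card))) ^ p) := by
  classical
  obtain ⟨P, hP, hcov⟩ := exists_reps S
  obtain ⟨G0⟩ := hne
  have hinj : Function.Injective S.neg := fun a b h => by rw [← S.neg_neg a, h, S.neg_neg]
  have hex : ∃ n, ∃ x, SigBalanced S x ∧ ∑ a, x a = n := ⟨_, _, G0.balanced, rfl⟩
  obtain ⟨x, hx, hn⟩ := Nat.find_spec hex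
  have hmin := fun n => @Nat.find_min' _ _ hex n
  rw [← hn] at hmin
  obtain ⟨G, hG⟩ := hx.exists_graph
  set κ := max 1 (min P.card (Finset.univ.sup fun a : S.Lab => (S.Da a).card)) with hκ
  refine ⟨G, P.card, ?_, ?_⟩
  · have := Finset.card_le_univ (P ∪ P.image S.neg)
    rw [Finset.card_union_of_disjoint hP, Finset.card_image_of_injective _ hinj] at this
    omega
  have hcol : ∀ a, ∑ i, |balMat S P i a| ≤ (κ : ℤ) := fun a => by
    refine (balMat_col S P hP a).trans ?_
    have : (S.Da a).card ≤ Finset.univ.sup fun a : S.Lab => (S.Da a).card :=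
      Finset.le_sup (f := fun a : S.Lab => (S.Da a).card) (Finset.mem_univ a)
    have h2 : min P.card (S.Da a).card ≤ κ := le_max_of_le_right (min_le_min_left _ this)
    exact_mod_cast h2
  have := sum_bound (balMat S P) κ (by exact_mod_cast le_max_left _ _) hcol S.init
    (Fintype.card S.Lab) (fun a => (x a : ℚ)) (Finset.card_le_univ _) (fun a => by positivity)
    (fun d => by
      have h1 := balMat_mul S P (fun a => (x a : ℤ)) d
      have h2 := hx.1 d.1
      have h3 : ∑ a, balMat S P d a * (x a : ℤ) = 0 := by
        rw [h1, sub_eq_zero]; exact_mod_cast h2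
      exact_mod_cast h3)
    (by exact_mod_cast hx.2.le)
    (fun v hv1 hv2 hv3 hv4 hv5 => by
      have hv5' : ∀ a, v a ≤ (x a : ℤ) := fun a => by exact_mod_cast hv5 a
      obtain ⟨w, hw⟩ : ∃ w : S.Lab → ℕ, ∀ a, v a = w a :=
        ⟨fun a => (v a).toNat, fun a => by simp [hv1 a]⟩
      have hle : ∀ a, w a ≤ x a := fun a => by have := hv5' a; rw [hw] at this; exact_mod_cast this
      simp only [hw] at hv3 hv4
      have hbw : ∀ d, ∑ a with d ∈ S.Da a, w a = ∑ a with S.neg d ∈ S.Da a, w a := by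
        have hbP : ∀ d ∈ P, ∑ a with d ∈ S.Da a, w a = ∑ a with S.neg d ∈ S.Da a, w a := by
          intro d hd
          have h1 := hv3 ⟨d, hd⟩
          rw [balMat_mul, sub_eq_zero] at h1
          exact_mod_cast h1
        intro d
        rcases hcov d with h | h | h
        · exact hbP d h
        · have := hbP _ h
          rw [S.neg_neg] at this
          exact this.symm
        · rw [h]
      have hB : SigBalanced S (fun a => x a - w a) := by
        constructor
        · intro d
          rw [Finset.sum_tsub_distrib _ fun a _ => hle a, Finset.sum_tsub_distrib _ fun a _ => hle a, hx.1 d, hbw d]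
        · rw [Finset.sum_tsub_distrib _ fun a _ => hle a, hx.2]
          have : ∑ a ∈ S.init, w a = 0 := by exact_mod_cast hv4
          rw [this]
      have h1 := hmin _ ⟨_, hB, rfl⟩
      rw [Finset.sum_tsub_distrib _ fun a _ => hle a] at h1
      have h2 : ∑ a, w a ≠ 0 := by
        intro h
        apply hv2
        ext a
        rw [Finset.sum_eq_zero_iff] at h
        rw [hw, h a (Finset.mem_univ a)]; rfl
      have h3 : ∑ a, w a ≤ ∑ a, x a := Finset.sum_le_sum fun a _ => hle a
      omega)
  rw [hG]
  simp only [Fintype.card_coe] at this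
  exact_mod_cast this

/-- If at least one graph over `S` exists, `|D| ≥ 2`, and every `D_a` is non-empty, then,
with `r = |D|/2`, `m = |Σ|` and `k = max_a |D_a|`, there is a graph over `S` with at most
`2·m·r·min {r^r, k^(2r−2)}` nodes (the bound read as a real number). -/
theorem stmt1 (S : Signature) (hne : Nonempty (SigGraph S))
    (hD : 2 ≤ Fintype.card S.D) (hDa : ∀ a : S.Lab, (S.Da a).Nonempty)
    (r : ℝ) (hr : r = (Fintype.card S.D : ℝ) / 2)
    (m : ℕ) (hm : m = Fintype.card S.Lab)
    (k : ℕ) (hk : k = Finset.univ.sup fun a : S.Lab => (S.Da a).card) :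
    ∃ G : SigGraph S,
      (G.n : ℝ) ≤ 2 * m * r * min (r ^ r) ((k : ℝ) ^ (2 * r - 2)) := by
  obtain ⟨G, p, hp, hG⟩ := main_bound S hne
  refine ⟨G, ?_⟩
  have hk1 : 1 ≤ k := by
    have h1 := (hDa (G.lab G.v0)).card_pos
    have h2 : (S.Da (G.lab G.v0)).card ≤ k := by
      rw [hk]; exact Finset.le_sup (f := fun a : S.Lab => (S.Da a).card) (Finset.mem_univ _)
    omega
  rw [← hk, ← hm] at hG
  have hDr : (2 : ℝ) ≤ Fintype.card S.D := by exact_mod_cast hD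
  have hr1 : 1 ≤ r := by rw [hr]; linarith
  have hpr : (p : ℝ) ≤ r := by
    have : (2 * p : ℝ) ≤ Fintype.card S.D := by exact_mod_cast hp
    rw [hr]; linarith
  have hkr : (1 : ℝ) ≤ k := by exact_mod_cast hk1
  have h1 : ((max 1 (min p k) : ℕ) : ℝ) ^ p ≤ r ^ r := by
    calc ((max 1 (min p k) : ℕ) : ℝ) ^ p ≤ r ^ p := by
          gcongr
          push_cast
          exact max_le hr1 ((min_le_left _ _).trans hpr)
      _ = r ^ (p : ℝ) := (Real.rpow_natCast _ _).symm
      _ ≤ r ^ r := Real.rpow_le_rpow_of_exponent_le hr1 hpr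
  have h2 : ((max 1 (min p k) : ℕ) : ℝ) ^ p ≤ (k : ℝ) ^ (2 * r - 2) := by
    have hone : (1 : ℝ) ≤ (k : ℝ) ^ (2 * r - 2) := Real.one_le_rpow hkr (by linarith)
    rcases lt_or_ge p 2 with h | h
    · have : max 1 (min p k) = 1 := by omega
      rw [this]; simpa using hone
    · have : max 1 (min p k) ≤ k := by omega
      have h' : (2 : ℝ) ≤ p := by exact_mod_cast h
      calc ((max 1 (min p k) : ℕ) : ℝ) ^ p ≤ (k : ℝ) ^ p := by gcongr
        _ = (k : ℝ) ^ (p : ℝ) := (Real.rpow_natCast _ _).symm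
        _ ≤ _ := Real.rpow_le_rpow_of_exponent_le hkr (by linarith)
  have h3 : (p : ℝ) + 1 ≤ 2 * r := by linarith
  have hG' : (G.n : ℝ) ≤ m * ((p + 1) * ((max 1 (min p k) : ℕ) : ℝ) ^ p) := by exact_mod_cast hG
  calc (G.n : ℝ) ≤ m * ((p + 1) * ((max 1 (min p k) : ℕ) : ℝ) ^ p) := hG'
    _ ≤ m * ((2 * r) * min (r ^ r) ((k : ℝ) ^ (2 * r - 2))) := by
        gcongr
        exact le_min h1 h2
    _ = _ := by ring
end

section
/- Let S = (D, −, Σ, Σ₀, (D_a)_{a∈Σ}) be a signature with k ≥ 2 directions and with |D_a| ≥ 1 for all a ∈ Σ, and let A_* = (Q, T) be a star automaton over S with n states and s stars. If A_* accepts at least one graph, then the accepted graph with the minimal number of nodes has at most s·n²·k^{k·n²−1} nodes. -/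
lemma aux_det_le {t : ℕ} (M : Matrix (Fin t) (Fin t) ℤ) (Δ : ℤ)
    (h : ∀ j, ∑ i, |M i j| ≤ Δ) : |M.det| ≤ Δ ^ t := by
  classical
  have h1 : |M.det| ≤ ∑ σ : Equiv.Perm (Fin t), ∏ i, |M (σ i) i| := by
    rw [Matrix.det_apply]
    refine (Finset.abs_sum_le_sum_abs _ _).trans (Finset.sum_le_sum fun σ _ => ?_)
    rcases Int.units_eq_one_or (Equiv.Perm.sign σ) with hs | hs <;>
      simp [hs, Finset.abs_prod]
  have h2 : ∑ σ : Equiv.Perm (Fin t), ∏ i, |M (σ i) i|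
      ≤ ∑ f : Fin t → Fin t, ∏ i, |M (f i) i| := by
    have := Finset.sum_map (Finset.univ : Finset (Equiv.Perm (Fin t)))
      ⟨fun σ => (σ : Fin t → Fin t), fun a b hab => Equiv.ext fun x => congrFun hab x⟩
      (fun f : Fin t → Fin t => ∏ i, |M (f i) i|)
    refine le_trans (le_of_eq this.symm) ?_
    exact Finset.sum_le_sum_of_subset_of_nonneg (Finset.subset_univ _)
      fun f _ _ => Finset.prod_nonneg fun i _ => abs_nonneg _
  have h3 : ∑ f : Fin t → Fin t, ∏ i, |M (f i) i| = ∏ i, ∑ j, |M j i| := by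
    rw [Finset.prod_univ_sum]; simp
  have h4 : ∏ i, ∑ j, |M j i| ≤ Δ ^ t := by
    have := Finset.prod_le_prod (s := (Finset.univ : Finset (Fin t)))
      (f := fun i => ∑ j, |M j i|) (g := fun _ => Δ)
      (fun i _ => Finset.sum_nonneg fun j _ => abs_nonneg _) (fun i _ => h i)
    simpa using this
  linarith

lemma aux_kernel {E T : Type} [Fintype E] [Fintype T] [DecidableEq T] (A : E → T → ℤ) (Δ : ℤ)
    (hΔ : 1 ≤ Δ) (hA : ∀ t, ∑ e, |A e t| ≤ Δ) (z : T → ℚ) (hz : z ≠ 0)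
    (hAz : ∀ e, ∑ t, (A e t : ℚ) * z t = 0) :
    ∃ y : T → ℤ, y ≠ 0 ∧ (∀ t, z t = 0 → y t = 0) ∧ (∀ e, ∑ t, A e t * y t = 0) ∧
      ∑ t, |y t| ≤ (Fintype.card E + 1) * Δ ^ Fintype.card E := by
  classical
  let Pr : ℕ → Prop := fun t => ∃ (f : Fin t → E) (g : Fin t → T), (∀ i, z (g i) ≠ 0) ∧
    (Matrix.of fun i j => A (f i) (g j)).det ≠ 0
  have hinj : ∀ (t : ℕ) (f : Fin t → E) (g : Fin t → T),
      (Matrix.of fun i j => A (f i) (g j)).det ≠ 0 → Function.Injective f := by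
    intro t f g hd a b hab
    by_contra hne
    exact hd (Matrix.det_zero_of_row_eq hne (by ext j; simp [hab]))
  have hle : ∀ t, Pr t → t ≤ Fintype.card E := by
    rintro t ⟨f, g, -, hd⟩
    simpa using Fintype.card_le_of_injective f (hinj t f g hd)
  have hex : ∃ t, Pr t ∧ ¬ Pr (t + 1) := by
    by_contra! hcon
    have : ∀ t, Pr t := by
      intro t
      induction t with
      | zero => exact ⟨Fin.elim0, Fin.elim0, fun i => i.elim0, by simp⟩
      | succ t ih => exact hcon t ih
    have := hle _ (this (Fintype.card E + 1))
    omega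
  obtain ⟨t, hP, hN⟩ := hex
  have ht := hle t hP
  obtain ⟨f, g, hg, hd⟩ := hP
  have hf := hinj t f g hd
  by_cases hj : ∃ j0, z j0 ≠ 0 ∧ ∀ i, g i ≠ j0
  · obtain ⟨j0, hj0, hj1⟩ := hj
    let g' : Fin (t + 1) → T := Fin.cons j0 g
    have hg' : ∀ i, z (g' i) ≠ 0 := by
      intro i
      refine Fin.cases ?_ (fun i => ?_) i
      · simpa [g'] using hj0
      · simpa [g'] using hg i
    let c : Fin (t + 1) → ℤ := fun i =>
      (-1) ^ (i : ℕ) * (Matrix.of fun a b => A (f a) (g' (i.succAbove b))).det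
    have hc : ∀ i, |c i| ≤ Δ ^ t := by
      intro i
      have : |c i| = |(Matrix.of fun a b => A (f a) (g' (i.succAbove b))).det| := by
        simp [c, abs_mul]
      rw [this]
      apply aux_det_le
      intro j
      refine le_trans ?_ (hA (g' (i.succAbove j)))
      have := Finset.sum_map (Finset.univ : Finset (Fin t)) ⟨f, hf⟩
        (fun e => |A e (g' (i.succAbove j))|)
      simp only [Function.Embedding.coeFn_mk] at this
      simp only [Matrix.of_apply]
      rw [← this]
      exact Finset.sum_le_sum_of_subset_of_nonneg (Finset.subset_univ _)
        fun f _ _ => abs_nonneg _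
    have hker : ∀ e, ∑ i, A e (g' i) * c i = 0 := by
      intro e
      by_contra hne
      apply hN
      refine ⟨Fin.cons e f, g', hg', ?_⟩
      rw [Matrix.det_succ_row_zero]
      convert hne using 1
      refine Finset.sum_congr rfl fun i _ => ?_
      have : (Matrix.of fun i j => A ((Fin.cons e f : Fin (t+1) → E) i) (g' j)).submatrix
        Fin.succ i.succAbove = Matrix.of fun a b => A (f a) (g' (i.succAbove b)) := by
        ext a b; simp
      rw [this]
      simp [c]; ring
    refine ⟨fun s => ∑ i, if g' i = s then c i else 0, ?_, ?_, ?_, ?_⟩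
    · intro h0
      have := congrFun h0 j0
      rw [Fin.sum_univ_succ] at this
      simp [g', hj1, c] at this
      exact hd this
    · intro s hs
      refine Finset.sum_eq_zero fun i _ => ?_
      rw [if_neg]
      rintro rfl
      exact hg' i hs
    · intro e
      refine Eq.trans ?_ (hker e)
      simp_rw [Finset.mul_sum]
      rw [Finset.sum_comm]
      simp
    · calc ∑ s, |∑ i, if g' i = s then c i else 0|
          ≤ ∑ s, ∑ i, |if g' i = s then c i else 0| :=
            Finset.sum_le_sum fun s _ => Finset.abs_sum_le_sum_abs _ _
        _ = ∑ i, |c i| := by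
            rw [Finset.sum_comm]
            refine Finset.sum_congr rfl fun i _ => ?_
            simp [apply_ite abs]
        _ ≤ ∑ i : Fin (t + 1), Δ ^ t := Finset.sum_le_sum fun i _ => hc i
        _ = (t + 1) * Δ ^ t := by simp
        _ ≤ _ := by
            have : Δ ^ t ≤ Δ ^ Fintype.card E := pow_le_pow_right₀ hΔ ht
            have h2 : (t : ℤ) ≤ Fintype.card E := by exact_mod_cast ht
            have h3 : 0 ≤ Δ ^ t := by positivity
            exact mul_le_mul (by linarith) this h3 (by positivity)
  · exfalso
    push Not at hj
    have hgi : Function.Injective g := by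
      intro a b hab
      by_contra hne
      exact hd (Matrix.det_zero_of_column_eq hne (by intro j; simp [hab]))
    have hd' : ((Matrix.of fun i j => A (f i) (g j)).map (Int.cast : ℤ → ℚ)).det ≠ 0 := by
      have := Int.cast_det (R := ℚ) (Matrix.of fun i j => A (f i) (g j))
      rw [← this]
      exact_mod_cast hd
    have h0 := Matrix.eq_zero_of_mulVec_eq_zero hd' (v := fun i => z (g i)) (by
      ext a
      simp only [Matrix.mulVec, dotProduct, Matrix.map_apply, Matrix.of_apply, Pi.zero_apply]
      rw [← hAz (f a)]
      refine Fintype.sum_of_injective g hgi _ _ ?_ (fun _ => rfl)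
      intro s hs
      by_cases hzs : z s = 0
      · simp [hzs]
      · obtain ⟨i, hi⟩ := hj s hzs
        exact absurd ⟨i, hi⟩ hs)
    apply hz
    ext s
    by_contra hzs
    obtain ⟨i, rfl⟩ := hj s hzs
    exact hzs (congrFun h0 i)

/-- subtract the largest possible multiple -/
lemma aux_ratio {T : Type} [Fintype T] (z y : T → ℚ) (hz : ∀ t, 0 ≤ z t)
    (hy : ∃ t, 0 < y t) (hs : ∀ t, z t = 0 → y t = 0) :
    ∃ c : ℚ, 0 < c ∧ (∀ t, 0 ≤ z t - c * y t) ∧ ∃ t, z t ≠ 0 ∧ z t - c * y t = 0 := by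
  classical
  obtain ⟨t0, ht0⟩ := hy
  obtain ⟨t, ht, hmin⟩ := Finset.exists_min_image (Finset.univ.filter fun t => 0 < y t)
    (fun t => z t / y t) ⟨t0, by simp [ht0]⟩
  simp only [Finset.mem_filter, Finset.mem_univ, true_and] at ht hmin
  have hzt : z t ≠ 0 := fun h => by rw [hs t h] at ht; exact lt_irrefl _ ht
  have hpos : 0 < z t := lt_of_le_of_ne (hz t) (Ne.symm hzt)
  refine ⟨z t / y t, div_pos hpos ht, ?_, t, hzt, ?_⟩
  · intro u
    by_cases hu : 0 < y u
    · have := hmin u hu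
      rw [le_div_iff₀ hu] at this
      linarith
    · push Not at hu
      have := mul_nonpos_of_nonneg_of_nonpos (div_pos hpos ht).le hu
      have := hz u
      linarith
  · field_simp; ring

lemma aux_ray {E T : Type} [Fintype E] [Fintype T] [DecidableEq T] (A : E → T → ℤ) (Δ : ℤ)
    (hΔ : 1 ≤ Δ) (hA : ∀ t, ∑ e, |A e t| ≤ Δ) (N : ℕ) : ∀ (z : T → ℚ),
    (Finset.univ.filter fun t => z t ≠ 0).card ≤ N → z ≠ 0 → (∀ t, 0 ≤ z t) →
    (∀ e, ∑ t, (A e t : ℚ) * z t = 0) →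
    ∃ y : T → ℤ, y ≠ 0 ∧ (∀ t, 0 ≤ y t) ∧ (∀ t, z t = 0 → y t = 0) ∧
      (∀ e, ∑ t, A e t * y t = 0) ∧
      ∑ t, y t ≤ (Fintype.card E + 1) * Δ ^ Fintype.card E := by
  induction N with
  | zero =>
    intro z hN hz
    exfalso
    apply hz
    ext t
    have := Finset.card_eq_zero.mp (Nat.le_zero.mp hN)
    by_contra h
    have hm : t ∈ Finset.univ.filter fun t => z t ≠ 0 := by simpa using h
    rw [this] at hm
    simp at hm
  | succ N ih =>
    intro z hN hz hz0 hAz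
    obtain ⟨y, hy, hys, hAy, hyB⟩ := aux_kernel A Δ hΔ hA z hz hAz
    have habs : ∑ t, y t ≤ ∑ t, |y t| := Finset.sum_le_sum fun t _ => le_abs_self _
    have habs' : ∑ t, -y t ≤ ∑ t, |y t| := Finset.sum_le_sum fun t _ => neg_le_abs _
    by_cases h1 : ∀ t, 0 ≤ y t
    · exact ⟨y, hy, h1, hys, hAy, habs.trans hyB⟩
    by_cases h2 : ∀ t, y t ≤ 0
    · refine ⟨-y, by simpa using hy, fun t => by simpa using h2 t, fun t ht => by simp [hys t ht],
        fun e => by simp [hAy e], le_trans habs' hyB⟩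
    push Not at h1 h2
    obtain ⟨a, ha⟩ := h1
    obtain ⟨b, hb⟩ := h2
    obtain ⟨c, hc, hcz, t0, ht0, ht0'⟩ := aux_ratio z (fun t => (y t : ℚ)) hz0
      ⟨b, by exact_mod_cast hb⟩ (fun t ht => by simp [hys t ht])
    obtain ⟨w, hw, hw0, hws, hAw, hwB⟩ := ih (fun t => z t - c * y t) (by
        have : (Finset.univ.filter fun t => z t - c * y t ≠ 0) ⊂
            (Finset.univ.filter fun t => z t ≠ 0) := by
          rw [Finset.ssubset_iff_of_subset]
          · exact ⟨t0, by simpa using ht0, by simpa using ht0'⟩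
          · intro t ht
            simp only [Finset.mem_filter, Finset.mem_univ, true_and] at ht ⊢
            intro h
            apply ht
            simp [h, hys t h]
        have := Finset.card_lt_card this
        omega) (by
        intro h
        have h3 := congrFun h a
        simp only [Pi.zero_apply] at h3
        have h4 : (y a : ℚ) < 0 := by exact_mod_cast ha
        have h5 := mul_neg_of_pos_of_neg hc h4
        have := hz0 a
        linarith) hcz (by
        intro e
        have h3 : ∑ t, (A e t : ℚ) * y t = 0 := by exact_mod_cast hAy e
        have h4 : ∑ t, (A e t : ℚ) * (z t - c * y t)
          = ∑ t, (A e t : ℚ) * z t - c * ∑ t, (A e t : ℚ) * y t := by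
          rw [Finset.mul_sum, ← Finset.sum_sub_distrib]
          exact Finset.sum_congr rfl fun t _ => by ring
        rw [h4, hAz, h3]; simp)
    refine ⟨w, hw, hw0, fun t ht => hws t ?_, hAw, hwB⟩
    simp [ht, hys t ht]

lemma aux_core {E T : Type} [Fintype E] [Fintype T] [DecidableEq T] (A : E → T → ℤ) (Δ : ℤ)
    (hΔ : 1 ≤ Δ) (hA : ∀ t, ∑ e, |A e t| ≤ Δ) (w : T → ℤ) (hw : ∀ t, 0 ≤ w t)
    (x0 : T → ℕ) (hx0 : ∀ e, ∑ t, A e t * x0 t = 0) (hwx0 : ∑ t, w t * x0 t = 1) :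
    ∃ x : T → ℕ, (∀ e, ∑ t, A e t * x t = 0) ∧ ∑ t, w t * x t = 1 ∧
      ∑ t, (x t : ℤ) ≤ Fintype.card T * ((Fintype.card E + 1) * Δ ^ Fintype.card E) := by
  classical
  set B : ℤ := (Fintype.card E + 1) * Δ ^ Fintype.card E with hB
  have hB0 : 0 ≤ B := by positivity
  let Sol : ℕ → Prop := fun N => ∃ x : T → ℕ, (∀ e, ∑ t, A e t * x t = 0) ∧
    ∑ t, w t * x t = 1 ∧ ∑ t, x t = N
  have hSol : ∃ N, Sol N := ⟨_, x0, hx0, hwx0, rfl⟩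
  obtain ⟨x, hx, hwx, hxN⟩ := Nat.find_spec hSol
  have hmin : ∀ x' : T → ℕ, (∀ e, ∑ t, A e t * x' t = 0) → ∑ t, w t * x' t = 1 →
      ∑ t, x t ≤ ∑ t, x' t := by
    intro x' h1 h2
    rw [hxN]
    exact Nat.find_min' hSol ⟨x', h1, h2, rfl⟩
  refine ⟨x, hx, hwx, ?_⟩
  -- coefficient bound
  have hcoef : ∀ (y : T → ℤ) (c : ℚ), y ≠ 0 → (∀ t, 0 ≤ y t) → (∀ e, ∑ t, A e t * y t = 0) →
      0 < c → (∀ t, c * y t ≤ x t) → c ≤ 1 := by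
    intro y c hy hy0 hAy hc hcx
    by_contra! hc1
    have hyx : ∀ t, y t ≤ x t := by
      intro t
      have h1 : (0 : ℚ) ≤ y t := by exact_mod_cast hy0 t
      have h2 := hcx t
      have : (y t : ℚ) ≤ x t := by nlinarith
      exact_mod_cast this
    have hwy0 : 0 ≤ ∑ t, w t * y t := Finset.sum_nonneg fun t _ => mul_nonneg (hw t) (hy0 t)
    have hwy : ∑ t, w t * y t = 0 := by
      by_contra hne
      have h1 : 1 ≤ ∑ t, w t * y t := by omega
      have h1' : (1 : ℚ) ≤ ∑ t, (w t : ℚ) * y t := by exact_mod_cast h1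
      have h2 : ∑ t, (w t : ℚ) * x t = 1 := by exact_mod_cast hwx
      have h3 : c * ∑ t, (w t : ℚ) * y t ≤ ∑ t, (w t : ℚ) * x t := by
        rw [Finset.mul_sum]
        refine Finset.sum_le_sum fun t _ => ?_
        have h4 : (0 : ℚ) ≤ w t := by exact_mod_cast hw t
        have := mul_le_mul_of_nonneg_left (hcx t) h4
        linarith
      nlinarith
    have hcast : ∀ t, (((x t : ℤ) - y t).toNat : ℤ) = x t - y t := by
      intro t
      have := hyx t
      omega
    have h5 := hmin (fun t => ((x t : ℤ) - y t).toNat)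
      (by
        intro e
        simp only [hcast, mul_sub, Finset.sum_sub_distrib]
        rw [hx, hAy]; simp)
      (by
        simp only [hcast, mul_sub, Finset.sum_sub_distrib]
        rw [hwx, hwy]; simp)
    have h6 : (∑ t, (x t : ℤ)) ≤ ∑ t, ((x t : ℤ) - y t) := by
      have : ((∑ t, x t : ℕ) : ℤ) ≤ ((∑ t, ((x t : ℤ) - y t).toNat : ℕ) : ℤ) := by
        exact_mod_cast h5
      push_cast [hcast] at this
      simpa [hcast] using this
    rw [Finset.sum_sub_distrib] at h6
    have h7 : ∑ t, y t = 0 := le_antisymm (by linarith) (Finset.sum_nonneg fun t _ => hy0 t)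
    rw [Finset.sum_eq_zero_iff_of_nonneg fun t _ => hy0 t] at h7
    exact hy (funext fun t => h7 t (Finset.mem_univ t))
  have key : ∀ (N : ℕ) (z : T → ℚ), (Finset.univ.filter fun t => z t ≠ 0).card ≤ N →
      (∀ t, 0 ≤ z t) → (∀ t, z t ≤ x t) → (∀ e, ∑ t, (A e t : ℚ) * z t = 0) →
      ∑ t, z t ≤ N * B := by
    intro N
    induction N with
    | zero =>
      intro z hN _ _ _
      have h := Finset.card_eq_zero.mp (Nat.le_zero.mp hN)
      have : ∀ t, z t = 0 := by
        intro t
        by_contra h'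
        have hm : t ∈ Finset.univ.filter fun t => z t ≠ 0 := by simpa using h'
        rw [h] at hm
        simp at hm
      simp [this]
    | succ N ih =>
      intro z hN hz0 hzx hAz
      by_cases hz : z = 0
      · have : (0 : ℚ) ≤ B := by exact_mod_cast hB0
        simp only [hz, Pi.zero_apply, Finset.sum_const_zero]
        positivity
      obtain ⟨y, hy, hy0, hys, hAy, hyB⟩ := aux_ray A Δ hΔ hA (N + 1) z hN hz hz0 hAz
      have hypos : ∃ t, 0 < y t := by
        by_contra! h
        exact hy (funext fun t => le_antisymm (h t) (hy0 t))
      obtain ⟨b, hb⟩ := hypos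
      obtain ⟨c, hc, hcz, t0, ht0, ht0'⟩ := aux_ratio z (fun t => (y t : ℚ)) hz0
        ⟨b, by exact_mod_cast hb⟩ (fun t ht => by simp [hys t ht])
      have hc1 : c ≤ 1 := hcoef y c hy hy0 hAy hc fun t => by
        have := hcz t
        have := hzx t
        linarith
      have hrec := ih (fun t => z t - c * y t) (by
        have : (Finset.univ.filter fun t => z t - c * y t ≠ 0) ⊂
            (Finset.univ.filter fun t => z t ≠ 0) := by
          rw [Finset.ssubset_iff_of_subset]
          · exact ⟨t0, by simpa using ht0, by simpa using ht0'⟩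
          · intro t ht
            simp only [Finset.mem_filter, Finset.mem_univ, true_and] at ht ⊢
            intro h
            apply ht
            simp [h, hys t h]
        have := Finset.card_lt_card this
        omega) hcz (by
        intro t
        have h4 : (0 : ℚ) ≤ y t := by exact_mod_cast hy0 t
        have := mul_nonneg hc.le h4
        have := hzx t
        linarith) (by
        intro e
        have h3 : ∑ t, (A e t : ℚ) * y t = 0 := by exact_mod_cast hAy e
        have h4 : ∑ t, (A e t : ℚ) * (z t - c * y t)
          = ∑ t, (A e t : ℚ) * z t - c * ∑ t, (A e t : ℚ) * y t := by
          rw [Finset.mul_sum, ← Finset.sum_sub_distrib]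
          exact Finset.sum_congr rfl fun t _ => by ring
        rw [h4, hAz, h3]; simp)
      rw [Finset.sum_sub_distrib, ← Finset.mul_sum] at hrec
      have h8 : ∑ t, (y t : ℚ) ≤ B := by exact_mod_cast hyB
      have h9 : (0 : ℚ) ≤ ∑ t, (y t : ℚ) := Finset.sum_nonneg fun t _ => by exact_mod_cast hy0 t
      have h10 : c * ∑ t, (y t : ℚ) ≤ ∑ t, (y t : ℚ) := mul_le_of_le_one_left h9 hc1
      push_cast
      linarith
  have := key (Fintype.card T) (fun t => (x t : ℚ)) (Finset.card_le_univ _)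
    (fun t => by positivity) (fun t => le_rfl) (fun e => by exact_mod_cast hx e)
  exact_mod_cast this

lemma aux_match {V E : Type} [Fintype V] [DecidableEq V] (σ : E → E) (hσ : ∀ e, σ (σ e) = e)
    (r : E → ℕ) (hr : Function.Injective r) (H : V → E → Prop) [∀ e, DecidablePred fun v => H v e]
    (hcard : ∀ e, (Finset.univ.filter fun v => H v e).card
      = (Finset.univ.filter fun v => H v (σ e)).card) :
    ∃ g : E → V → V, ∀ e v, H v e → H (g e v) (σ e) ∧ g (σ e) (g e v) = v := by
  classical
  have hpair : ∀ e, ∃ g1 g2 : V → V, (σ e = e → g1 = id) ∧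
      (∀ v, H v e → H (g1 v) (σ e) ∧ g2 (g1 v) = v) ∧
      (∀ v, H v (σ e) → H (g2 v) e ∧ g1 (g2 v) = v) := by
    intro e
    by_cases he : σ e = e
    · exact ⟨id, id, fun _ => rfl, fun v hv => by simpa [he] using hv,
        fun v hv => by simpa [he] using hv⟩
    · have β := Finset.equivOfCardEq (hcard e)
      refine ⟨fun v => if h : H v e then (β ⟨v, by simpa using h⟩).1 else v,
        fun v => if h : H v (σ e) then (β.symm ⟨v, by simpa using h⟩).1 else v,
        fun h => absurd h he, ?_, ?_⟩
      · intro v hv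
        have h1 : H (β ⟨v, by simpa using hv⟩).1 (σ e) := by
          have := (β ⟨v, by simpa using hv⟩).2
          exact (Finset.mem_filter.mp this).2
        simp [hv, h1]
      · intro v hv
        have h1 : H (β.symm ⟨v, by simpa using hv⟩).1 e := by
          have := (β.symm ⟨v, by simpa using hv⟩).2
          exact (Finset.mem_filter.mp this).2
        simp [hv, h1]
  choose g1 g2 hid h12 h21 using hpair
  refine ⟨fun e => if r e ≤ r (σ e) then g1 e else g2 (σ e), fun e v hv => ?_⟩
  rcases lt_trichotomy (r e) (r (σ e)) with h | h | h
  · have hpq := h12 e v hv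
    simp only [hσ, h.le, if_true, not_le.mpr h, if_false]
    exact hpq
  · have he : σ e = e := (hr h).symm
    simp only [he, le_refl, if_true, hid e he, id]
    exact ⟨hv, trivial⟩
  · have hpq := h21 (σ e) v (by rwa [hσ])
    simp only [hσ, h.le, if_true, not_le.mpr h, if_false]
    exact hpq

/-- The star `t` has centre state `p` and a ray in direction `d` with state `q`. -/
def auxHas {S : Signature} (A : StarAutomaton S)
    (t : Σ a : S.Lab, A.Q × ({d // d ∈ S.Da a} → A.Q)) (e : S.D × A.Q × A.Q) : Prop :=
  ∃ h : e.1 ∈ S.Da t.1, t.2.1 = e.2.1 ∧ t.2.2 ⟨e.1, h⟩ = e.2.2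

/-- The reversal of an edge type. -/
def auxRev {S : Signature} (A : StarAutomaton S) (e : S.D × A.Q × A.Q) : S.D × A.Q × A.Q :=
  (S.neg e.1, e.2.2, e.2.1)

lemma auxRev_auxRev {S : Signature} (A : StarAutomaton S) (e : S.D × A.Q × A.Q) :
    auxRev A (auxRev A e) = e := by
  simp [auxRev, S.neg_neg]

lemma aux_count {V T : Type} [Fintype V] [Fintype T] [DecidableEq T] (st : V → T) (x : T → ℕ)
    (hx : ∀ t, x t = (Finset.univ.filter fun v => st v = t).card) (P : T → Prop)
    [DecidablePred P] :
    ∑ t, (if P t then x t else 0) = (Finset.univ.filter fun v => P (st v)).card := by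
  rw [Finset.card_eq_sum_card_fiberwise (f := st) (t := Finset.univ) (by simp)]
  refine Finset.sum_congr rfl fun t _ => ?_
  rw [Finset.filter_filter]
  split_ifs with h
  · rw [hx]
    congr 1
    ext v
    simp only [Finset.mem_filter, Finset.mem_univ, true_and]
    constructor
    · rintro rfl; exact ⟨h, rfl⟩
    · exact fun h => h.2
  · symm
    rw [Finset.card_eq_zero, Finset.filter_eq_empty_iff]
    rintro v - ⟨h1, rfl⟩
    exact h h1

open Classical in
lemma aux_from_graph {S : Signature} (A : StarAutomaton S) (G : SigGraph S)
    (q : Fin G.n → A.Q) (hq : A.IsComputation G q) :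
    ∃ x : {t // t ∈ A.T} → ℕ,
      (∀ e, ∑ t, (if auxHas A t.1 e then x t else 0)
        = ∑ t, (if auxHas A t.1 (auxRev A e) then x t else 0)) ∧
      ∑ t, (if t.1.1 ∈ S.init then x t else 0) = 1 := by
  let st : Fin G.n → {t // t ∈ A.T} := fun v => ⟨_, hq v⟩
  have hc := fun (P : {t // t ∈ A.T} → Prop) [DecidablePred P] =>
    aux_count st (fun t => (Finset.univ.filter fun v => st v = t).card) (fun t => rfl) P
  refine ⟨fun t => (Finset.univ.filter fun v => st v = t).card, ?_, ?_⟩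
  · have hle : ∀ e, (Finset.univ.filter fun v => auxHas A (st v).1 e).card
        ≤ (Finset.univ.filter fun v => auxHas A (st v).1 (auxRev A e)).card := by
      intro e
      have hmain : ∀ v, auxHas A (st v).1 e → ∃ u, G.edge v e.1 = some u ∧
          auxHas A (st u).1 (auxRev A e) ∧ G.edge u (S.neg e.1) = some v := by
        rintro v ⟨hd, h1, h2⟩
        obtain ⟨u, hu⟩ := Option.isSome_iff_exists.mp ((G.edge_dom v e.1).mpr hd)
        have hu' := G.edge_sym _ _ _ hu
        refine ⟨u, hu, ⟨(G.edge_dom u _).mp (by simp [auxRev, hu']), ?_, ?_⟩, hu'⟩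
        · change q u = e.2.2
          rw [← h2]
          simp [st, SigGraph.nbr, hu]
        · change q (G.nbr u (S.neg e.1) _) = e.2.1
          rw [← h1]
          simp [st, SigGraph.nbr, hu']
      refine Finset.card_le_card_of_injOn (fun v => (G.edge v e.1).getD v) ?_ ?_
      · intro v hv
        obtain ⟨u, hu, hu1, -⟩ := hmain v (by simpa using hv)
        simpa [hu] using hu1
      · intro v hv w hw hvw
        obtain ⟨u, hu, -, hu2⟩ := hmain v (by simpa using hv)
        obtain ⟨u', hu', -, hu2'⟩ := hmain w (by simpa using hw)
        simp only [hu, hu', Option.getD_some] at hvw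
        subst hvw
        rw [hu2] at hu2'
        exact Option.some_injective _ hu2'
    intro e
    rw [hc fun t => auxHas A t.1 e, hc fun t => auxHas A t.1 (auxRev A e)]
    refine le_antisymm (hle e) ?_
    have := hle (auxRev A e)
    rwa [auxRev_auxRev] at this
  · rw [hc fun t => t.1.1 ∈ S.init]
    rw [Finset.card_eq_one]
    refine ⟨G.v0, ?_⟩
    ext v
    simp [st, G.init_iff]

open Classical in
lemma aux_to_graph' {S : Signature} (A : StarAutomaton S) (N : ℕ)
    (st : Fin N → {t // t ∈ A.T})
    (h1 : ∀ e, (Finset.univ.filter fun v => auxHas A (st v).1 e).card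
        = (Finset.univ.filter fun v => auxHas A (st v).1 (auxRev A e)).card)
    (h2 : (Finset.univ.filter fun v => (st v).1.1 ∈ S.init).card = 1) :
    ∃ G : SigGraph S, A.Accepts G ∧ G.n = N := by
  obtain ⟨v0, hv0⟩ := Finset.card_eq_one.mp h2
  obtain ⟨g, hg⟩ := aux_match (auxRev A) (auxRev_auxRev A)
    (fun e => (Fintype.equivFin _ e : ℕ)) (fun a b hab => by simpa [Fin.val_inj] using hab)
    (fun v e => auxHas A (st v).1 e) h1
  let et : (v : Fin N) → (d : S.D) → d ∈ S.Da (st v).1.1 → S.D × A.Q × A.Q :=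
    fun v d h => (d, (st v).1.2.1, (st v).1.2.2 ⟨d, h⟩)
  have het : ∀ v d h, auxHas A (st v).1 (et v d h) := fun v d h => ⟨h, rfl, rfl⟩
  let edge : Fin N → S.D → Option (Fin N) := fun v d =>
    if h : d ∈ S.Da (st v).1.1 then some (g (et v d h) v) else none
  let G : SigGraph S :=
    { n := N
      v0 := v0
      edge := edge
      lab := fun v => (st v).1.1
      edge_sym := by
        intro v d u huv
        by_cases h : d ∈ S.Da (st v).1.1
        · simp only [edge, h, dif_pos, Option.some.injEq] at huv
          obtain ⟨⟨ha, hb, hc⟩, hgg⟩ := hg _ _ (het v d h)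
          rw [huv] at hgg
          rw [← huv]
          have h' : S.neg d ∈ S.Da (st (g (et v d h) v)).1.1 := ha
          have : et (g (et v d h) v) (S.neg d) h' = auxRev A (et v d h) := by
            refine Prod.ext rfl (Prod.ext ?_ ?_)
            · exact hb
            · exact hc
          simp only [edge, h', dif_pos, this]
          rw [huv, hgg]
        · simp [edge, h] at huv
      edge_dom := by
        intro v d
        by_cases h : d ∈ S.Da (st v).1.1 <;> simp [edge, h]
      init_iff := by
        intro v
        have := Finset.ext_iff.mp hv0 v
        simpa using this }
  refine ⟨G, ⟨fun v => (st v).1.2.1, ?_⟩, rfl⟩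
  intro v
  have hs := (st v).2
  convert hs using 1
  refine Sigma.ext rfl (heq_of_eq (Prod.ext rfl (funext fun d => ?_)))
  have hnb : G.nbr v d.1 d.2 = g (et v d.1 d.2) v := by
    simp only [SigGraph.nbr]
    apply Option.get_of_eq_some
    have hd : d.1 ∈ S.Da (st v).1.1 := d.2
    simp [G, edge, hd]
  change (st (G.nbr v d.1 d.2)).1.2.1 = _
  rw [hnb]
  obtain ⟨⟨ha, hb, hc⟩, hgg⟩ := hg _ _ (het v d.1 d.2)
  exact hb

open Classical in
lemma aux_to_graph {S : Signature} (A : StarAutomaton S) (x : {t // t ∈ A.T} → ℕ)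
    (h1 : ∀ e, ∑ t, (if auxHas A t.1 e then x t else 0)
        = ∑ t, (if auxHas A t.1 (auxRev A e) then x t else 0))
    (h2 : ∑ t, (if t.1.1 ∈ S.init then x t else 0) = 1) :
    ∃ G : SigGraph S, A.Accepts G ∧ G.n = ∑ t, x t := by
  let V := Σ t : {t // t ∈ A.T}, Fin (x t)
  have hV : Fintype.card V = ∑ t, x t := by simp [V]
  let φ : Fin (∑ t, x t) ≃ V := (Fintype.equivFinOfCardEq hV).symm
  let st : Fin (∑ t, x t) → {t // t ∈ A.T} := fun v => (φ v).1
  have hx : ∀ t, x t = (Finset.univ.filter fun v => st v = t).card := by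
    intro t
    have : (Finset.univ.filter fun v => st v = t).card
        = (Finset.univ.map ⟨fun i : Fin (x t) => φ.symm ⟨t, i⟩, fun a b hab => by
            have := φ.symm.injective hab
            exact eq_of_heq (Sigma.mk.inj this).2⟩).card := by
      congr 1
      ext v
      simp only [Finset.mem_filter, Finset.mem_univ, true_and, Finset.mem_map]
      constructor
      · rintro rfl
        exact ⟨(φ v).2, φ.symm_apply_apply v⟩
      · rintro ⟨i, rfl⟩
        change (φ (φ.symm ⟨t, i⟩)).1 = t
        rw [φ.apply_symm_apply]
    rw [this]; simp
  have hc := fun (P : {t // t ∈ A.T} → Prop) [DecidablePred P] => aux_count st x hx P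
  apply aux_to_graph' A _ st
  · intro e
    rw [← hc fun t => auxHas A t.1 e, ← hc fun t => auxHas A t.1 (auxRev A e)]
    exact h1 e
  · rw [← hc fun t => t.1.1 ∈ S.init]
    exact h2

open Classical in
lemma aux_main {S : Signature} (A : StarAutomaton S) (hacc : ∃ G : SigGraph S, A.Accepts G) :
    ∃ m : ℕ, 2 * m ≤ Fintype.card S.D * Fintype.card A.Q ^ 2 ∧
      ∀ Δ : ℕ, 1 ≤ Δ → min (Fintype.card S.D) m ≤ Δ →
      ∃ G : SigGraph S, A.Accepts G ∧ G.n ≤ A.T.card * ((m + 1) * Δ ^ m) := by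
  let r : S.D × A.Q × A.Q → ℕ := fun e => (Fintype.equivFin _ e : ℕ)
  have hr : Function.Injective r := fun a b hab => by simpa [r, Fin.val_inj] using hab
  have hrev : Function.Injective (auxRev A) :=
    Function.LeftInverse.injective (auxRev_auxRev A)
  let F : Finset (S.D × A.Q × A.Q) := Finset.univ.filter fun e => r e < r (auxRev A e)
  let F' : Finset (S.D × A.Q × A.Q) := F.map ⟨auxRev A, hrev⟩
  have hdisj : Disjoint F F' := by
    rw [Finset.disjoint_left]
    intro e he he'
    simp only [F, F', Finset.mem_map, Finset.mem_filter, Finset.mem_univ, true_and,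
      Function.Embedding.coeFn_mk] at he he'
    obtain ⟨e', h1, rfl⟩ := he'
    rw [auxRev_auxRev] at he
    omega
  let a : {e // e ∈ F} → {t // t ∈ A.T} → ℤ := fun e t =>
    (if auxHas A t.1 e.1 then 1 else 0) - (if auxHas A t.1 (auxRev A e.1) then 1 else 0)
  have hcardF : Fintype.card {e // e ∈ F} = F.card := by simp
  refine ⟨F.card, ?_, ?_⟩
  · have h1 : (F.disjUnion F' hdisj).card ≤ Fintype.card (S.D × A.Q × A.Q) :=
      Finset.card_le_univ _
    rw [Finset.card_disjUnion, Finset.card_map] at h1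
    simp only [Fintype.card_prod] at h1
    rw [pow_two]; omega
  intro Δ hΔ hmin
  have hcol : ∀ t, ∑ e, |a e t| ≤ (Δ : ℤ) := by
    intro t
    have hb1 : ∑ e, |a e t| ≤ (F.card : ℤ) := by
      calc ∑ e, |a e t| ≤ ∑ e : {e // e ∈ F}, (1 : ℤ) := Finset.sum_le_sum fun e _ => by
            simp only [a]; split_ifs <;> simp
        _ = _ := by simp
    have hb2 : ∑ e, |a e t| ≤ (Fintype.card S.D : ℤ) := by
      let P : S.D × A.Q × A.Q → ℤ := fun e => if auxHas A t.1 e then 1 else 0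
      calc ∑ e, |a e t| ≤ ∑ e : {e // e ∈ F}, (P e.1 + P (auxRev A e.1)) :=
            Finset.sum_le_sum fun e _ => by
              simp only [a, P]; split_ifs <;> simp
        _ = ∑ e ∈ F, (P e + P (auxRev A e)) :=
            Finset.sum_coe_sort F (fun e => P e + P (auxRev A e))
        _ = ∑ e ∈ F, P e + ∑ e ∈ F', P e := by
            rw [Finset.sum_add_distrib, Finset.sum_map]; rfl
        _ = ∑ e ∈ F.disjUnion F' hdisj, P e := by rw [Finset.sum_disjUnion]
        _ ≤ ∑ e, P e := Finset.sum_le_sum_of_subset_of_nonneg (Finset.subset_univ _)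
            fun e _ _ => by simp only [P]; split_ifs <;> simp
        _ = ((Finset.univ.filter fun e => auxHas A t.1 e).card : ℤ) := by
            simp [P]
        _ ≤ _ := by
            have : (Finset.univ.filter fun e => auxHas A t.1 e).card
                ≤ (Finset.univ : Finset S.D).card := by
              refine Finset.card_le_card_of_injOn Prod.fst (by simp) ?_
              rintro ⟨d, p, q⟩ he ⟨d', p', q'⟩ he' hdd
              simp only [Finset.coe_filter, Finset.mem_univ, true_and, Set.mem_ofPred_eq] at he he'
              obtain ⟨h, h1, h2⟩ := he
              obtain ⟨h', h1', h2'⟩ := he'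
              simp only at hdd h1 h2 h1' h2'
              subst hdd
              rw [← h1, ← h2, ← h1', ← h2']
            exact_mod_cast this
    rcases min_le_iff.mp hmin with h | h
    · have : (Fintype.card S.D : ℤ) ≤ Δ := by exact_mod_cast h
      linarith
    · have : (F.card : ℤ) ≤ Δ := by exact_mod_cast h
      linarith
  have hasum : ∀ (x : {t // t ∈ A.T} → ℕ) e, ∑ t, a e t * (x t : ℤ)
      = ((∑ t, (if auxHas A t.1 e.1 then x t else 0) : ℕ) : ℤ)
        - ((∑ t, (if auxHas A t.1 (auxRev A e.1) then x t else 0) : ℕ) : ℤ) := by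
    intro x e
    push_cast
    rw [← Finset.sum_sub_distrib]
    refine Finset.sum_congr rfl fun t _ => ?_
    simp only [a]; split_ifs <;> simp
  have hwsum : ∀ (x : {t // t ∈ A.T} → ℕ),
      ∑ t : {t // t ∈ A.T}, (if t.1.1 ∈ S.init then (1 : ℤ) else 0) * (x t : ℤ)
      = ((∑ t : {t // t ∈ A.T}, (if t.1.1 ∈ S.init then x t else 0) : ℕ) : ℤ) := by
    intro x
    push_cast
    refine Finset.sum_congr rfl fun t _ => ?_
    split_ifs <;> simp
  obtain ⟨G, q, hq⟩ := hacc
  obtain ⟨x0, hx0, hx0'⟩ := aux_from_graph A G q hq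
  obtain ⟨x, hx, hwx, hxB⟩ := aux_core a Δ (by exact_mod_cast hΔ) hcol
    (fun t => if t.1.1 ∈ S.init then (1 : ℤ) else 0) (fun t => by split_ifs <;> simp) x0
    (fun e => by rw [hasum, hx0 e.1, sub_self]) (by rw [hwsum, hx0']; rfl)
  rw [hwsum] at hwx
  have hx1 : ∀ e, r e < r (auxRev A e) → ∑ t, (if auxHas A t.1 e then x t else 0)
        = ∑ t, (if auxHas A t.1 (auxRev A e) then x t else 0) := by
    intro e he
    have := hx ⟨e, by simpa [F] using he⟩
    rw [hasum, sub_eq_zero] at this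
    exact_mod_cast this
  obtain ⟨G', hG', hn⟩ := aux_to_graph A x (by
    intro e
    rcases lt_trichotomy (r e) (r (auxRev A e)) with h | h | h
    · exact hx1 e h
    · rw [← hr h]
    · have := hx1 (auxRev A e) (by rwa [auxRev_auxRev])
      rw [auxRev_auxRev] at this
      exact this.symm) (by exact_mod_cast hwx)
  refine ⟨G', hG', ?_⟩
  rw [hn]
  rw [hcardF] at hxB
  simp only [Fintype.card_coe] at hxB
  exact_mod_cast hxB

/-- If a star automaton with `n` states and `s` stars over a signature with `k ≥ 2`
directions (all `D_a` non-empty) accepts at least one graph, then it accepts a graph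
with at most `s·n²·k^(k·n²−1)` nodes. -/
theorem stmt9 (S : Signature) (A : StarAutomaton S)
    (hD : 2 ≤ Fintype.card S.D) (hDa : ∀ a : S.Lab, (S.Da a).Nonempty)
    (k n s : ℕ)
    (hk : Fintype.card S.D = k) (hn : Fintype.card A.Q = n) (hs : A.T.card = s)
    (hacc : ∃ G : SigGraph S, A.Accepts G) :
    ∃ G : SigGraph S, A.Accepts G ∧ G.n ≤ s * n ^ 2 * k ^ (k * n ^ 2 - 1) := by
  have hn1 : 1 ≤ n := by
    obtain ⟨G, q, -⟩ := hacc
    rw [← hn]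
    exact Fintype.card_pos_iff.mpr ⟨q G.v0⟩
  obtain ⟨m, hm, hG⟩ := aux_main A hacc
  rw [hk] at hD hG
  rw [hk, hn] at hm
  rw [hs] at hG
  have hn2 : 1 ≤ n ^ 2 := Nat.one_le_pow _ _ hn1
  have hkK : k ≤ k * n ^ 2 := Nat.le_mul_of_pos_right _ hn2
  by_cases hK : k * n ^ 2 = 2
  · obtain ⟨G, hacc', hle⟩ := hG 1 le_rfl ((min_le_right _ _).trans (by omega))
    refine ⟨G, hacc', hle.trans ?_⟩
    have hk2 : k = 2 := by omega
    subst hk2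
    have : n ^ 2 = 1 := by omega
    rw [this]
    have : m + 1 ≤ 2 := by omega
    simpa using Nat.mul_le_mul_left s this
  · obtain ⟨G, hacc', hle⟩ := hG k (by omega) (min_le_left _ _)
    refine ⟨G, hacc', hle.trans ?_⟩
    rw [mul_assoc]
    refine Nat.mul_le_mul_left s ?_
    obtain ⟨j, hj⟩ : ∃ j, k * n ^ 2 - 1 = m + 1 + j := ⟨k * n ^ 2 - 1 - (m + 1), by omega⟩
    rw [hj]
    have h1 : m + 1 ≤ k * n ^ 2 := by omega
    calc (m + 1) * k ^ m ≤ (k * n ^ 2) * k ^ m := Nat.mul_le_mul_right _ h1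
      _ = n ^ 2 * k ^ (m + 1) := by ring
      _ ≤ n ^ 2 * k ^ (m + 1 + j) :=
        Nat.mul_le_mul_left _ (Nat.pow_le_pow_right (by omega) (by omega))
end

section
/- Let S = (D, −, Σ, Σ₀, (D_a)_{a∈Σ}) be a signature with k ≥ 2 directions, m node labels, and |D_a| ≥ 1 for every a ∈ Σ, and let A = (Q, q₀, F, δ) be a graph-walking automaton over S with n states. If A accepts at least one graph, then the smallest accepted graph has at most m·4^{n(k+1)}·k^{k·4^n − 1} nodes. -/
open Matrix in
lemma det_abs_le_s12 {ρ : Type*} [Fintype ρ] [DecidableEq ρ] (A : Matrix ρ ρ ℤ) (k : ℤ)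
    (h : ∀ j, ∑ r, |A r j| ≤ k) : |A.det| ≤ k ^ Fintype.card ρ := by
  rw [Matrix.det_apply']
  calc |∑ σ : Equiv.Perm ρ, ((Equiv.Perm.sign σ : ℤ)) * ∏ i, A (σ i) i|
      ≤ ∑ σ : Equiv.Perm ρ, |((Equiv.Perm.sign σ : ℤ)) * ∏ i, A (σ i) i| :=
        Finset.abs_sum_le_sum_abs _ _
    _ = ∑ σ : Equiv.Perm ρ, ∏ i, |A (σ i) i| := by
        refine Finset.sum_congr rfl fun σ _ => ?_
        rw [abs_mul, Finset.abs_prod]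
        rcases Int.units_eq_one_or (Equiv.Perm.sign σ) with h | h <;> simp [h]
    _ = ∑ f ∈ (Finset.univ : Finset (Equiv.Perm ρ)).image (fun σ : Equiv.Perm ρ => (⇑σ : ρ → ρ)),
          ∏ i, |A (f i) i| := by
        rw [Finset.sum_image]
        intro a _ b _ hab
        exact DFunLike.coe_injective hab
    _ ≤ ∑ f : ρ → ρ, ∏ i, |A (f i) i| := by
        apply Finset.sum_le_sum_of_subset_of_nonneg (Finset.subset_univ _)
        intro f _ _
        exact Finset.prod_nonneg fun i _ => abs_nonneg _
    _ = ∏ i, ∑ r, |A r i| := by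
        rw [Finset.prod_univ_sum, Fintype.piFinset_univ]
    _ ≤ ∏ _i : ρ, k := by
        apply Finset.prod_le_prod
        · intro i _
          exact Finset.sum_nonneg fun r _ => abs_nonneg _
        · intro i _
          exact h i
    _ = k ^ Fintype.card ρ := by simp

/-- the Cramer step -/
lemma cramer_step_s12 {ι ρ : Type*} [Fintype ι] [DecidableEq ι] [Fintype ρ] [DecidableEq ρ]
    (M : ρ → ι → ℤ) (k : ℕ) (hk : 1 ≤ k) (hcol : ∀ t, ∑ r, |M r t| ≤ k)
    (T : Finset ι) (t0 : ι)
    (hli : LinearIndepOn ℚ (fun t => (fun r => (M r t : ℚ) : ρ → ℚ)) (T : Set ι))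
    (x : ι → ℚ) (hx : ∀ r, ∑ t ∈ T, (M r t : ℚ) * x t = - (M r t0 * x t0)) :
    ∃ D : ℕ, 0 < D ∧ D ≤ k ^ Fintype.card ρ ∧
      ∀ t ∈ T, ∃ y : ℤ, |y| ≤ k ^ Fintype.card ρ ∧ |(y : ℚ) * x t0| = D * |x t| := by
  classical
  set v : ι → ρ → ℚ := fun t => (fun r => (M r t : ℚ)) with hv
  have hs : LinearIndepOn ℚ id (v '' (T : Set ι)) := hli.id_image
  set U : Set (ρ → ℚ) := v '' (T : Set ι) ∪ Set.range (fun r : ρ => (Pi.single r 1 : ρ → ℚ))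
  have hsU : v '' (T : Set ι) ⊆ U := Set.subset_union_left
  have hspan : ⊤ ≤ Submodule.span ℚ U := by
    rw [← (Pi.basisFun ℚ ρ).span_eq]
    apply Submodule.span_mono
    rintro _ ⟨r, rfl⟩
    right
    exact ⟨r, by simp⟩
  let b0 := Module.Basis.extendLe hs hsU hspan
  let e := b0.indexEquiv (Pi.basisFun ℚ ρ)
  let b := b0.reindex e
  have hbU : ∀ j, b j ∈ U := by
    intro j
    apply Module.Basis.extendLe_subset hs hsU hspan
    simp [b, b0]
  have hTb : ∀ t ∈ T, ∃ j, b j = v t := by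
    intro t ht
    have : v t ∈ Set.range b0 := Module.Basis.subset_extendLe hs hsU hspan ⟨t, ht, rfl⟩
    obtain ⟨i, hi⟩ := this
    exact ⟨e i, by simpa [b] using hi⟩
  have hC : ∀ j, ∃ C : ρ → ℤ, (∀ r, (C r : ℚ) = b j r) ∧ ∑ r, |C r| ≤ k := by
    intro j
    rcases hbU j with ⟨t, _, h⟩ | ⟨r, h⟩
    · exact ⟨fun r => M r t, fun r => by rw [← h], hcol t⟩
    · refine ⟨Pi.single r 1, fun r' => ?_, ?_⟩
      · rw [← h]
        by_cases h' : r' = r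
        · subst h'; simp
        · simp [h']
      · have : ∑ r', |(Pi.single r 1 : ρ → ℤ) r'| = 1 := by
          rw [Finset.sum_eq_single r] <;> simp +contextual
        rw [this]; exact_mod_cast hk
  choose C hCb hCk using hC
  let A : Matrix ρ ρ ℤ := Matrix.of fun r j => C j r
  have hA : A.det ≠ 0 := by
    have h1 : IsUnit (A.map (Int.cast : ℤ → ℚ)) := by
      rw [← Matrix.linearIndependent_cols_iff_isUnit]
      have : (A.map (Int.cast : ℤ → ℚ)).col = b := by
        ext j r
        simp [A, Matrix.col, hCb]
      rw [this]
      exact b.linearIndependent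
    rw [Matrix.isUnit_iff_isUnit_det, isUnit_iff_ne_zero] at h1
    have h2 : ((A.det : ℤ) : ℚ) = (A.map (Int.cast : ℤ → ℚ)).det := Int.cast_det A
    intro h0
    rw [h0] at h2
    exact h1 (by simpa using h2.symm)
  let c : ρ → ℤ := fun r => - M r t0
  let y := Matrix.cramer A c
  have hy : ∀ r, ∑ j, (b j r) * (y j : ℚ) = - (A.det * M r t0) := by
    intro r
    have h := congrFun (Matrix.mulVec_cramer A c) r
    have h' := congrArg (Int.cast : ℤ → ℚ) h
    simp only [Matrix.mulVec, dotProduct, A, Matrix.of_apply, Int.cast_sum, Int.cast_mul, hCb,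
      Pi.smul_apply, smul_eq_mul] at h'
    rw [h']
    simp [c, A]
  have hyk : ∀ j, |y j| ≤ k ^ Fintype.card ρ := by
    intro j
    simp only [y, Matrix.cramer_apply]
    apply det_abs_le_s12
    intro j'
    by_cases h : j' = j
    · subst h
      simpa [c] using hcol t0
    · simpa [Matrix.updateCol_apply, h, A] using hCk j'
  refine ⟨A.det.natAbs, Int.natAbs_pos.mpr hA, ?_, ?_⟩
  · have := det_abs_le_s12 A k (fun j => by simpa [A] using hCk j)
    zify
    exact this
  intro t ht
  have : Nonempty ρ := ⟨(hTb t ht).choose⟩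
  choose! jj hjj using hTb
  have hinj : Set.InjOn jj (T : Set ι) := by
    intro t ht t' ht' h
    apply hli.injOn ht ht'
    change v t = v t'
    rw [← hjj t ht, ← hjj t' ht', h]
  have hvec : ∑ j, ((y j : ℚ) * x t0) • b j = ∑ t ∈ T, ((A.det : ℚ) * x t) • b (jj t) := by
    ext r
    simp only [Finset.sum_apply, Pi.smul_apply, smul_eq_mul]
    have e1 : ∑ j, (y j : ℚ) * x t0 * b j r = (∑ j, (b j r) * (y j : ℚ)) * x t0 := by
      rw [Finset.sum_mul]
      exact Finset.sum_congr rfl fun j _ => by ring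
    have e2 : ∑ t ∈ T, (A.det : ℚ) * x t * b (jj t) r = A.det * ∑ t ∈ T, (M r t : ℚ) * x t := by
      rw [Finset.mul_sum]
      refine Finset.sum_congr rfl fun t ht => ?_
      rw [hjj t ht]
      simp only [hv]
      ring
    rw [e1, e2, hy, hx]
    ring
  refine ⟨y (jj t), hyk _, ?_⟩
  have h := congrArg (fun w => b.repr w (jj t)) hvec
  simp only [map_sum, map_smul, Module.Basis.repr_self, Finsupp.coe_finsetSum, Finset.sum_apply,
    Finsupp.smul_apply, Finsupp.single_apply, smul_eq_mul, mul_ite, mul_one, mul_zero] at h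
  rw [Finset.sum_ite_eq' ] at h
  rw [Finset.sum_eq_single t] at h
  · simp only [Finset.mem_univ, if_true] at h
    rw [h, abs_mul, Nat.cast_natAbs]
    push_cast
    rfl
  · intro t' ht' hne
    rw [if_neg]
    intro h'
    exact hne (hinj ht' ht h')
  · intro h'; exact absurd ht h'

lemma circuit {ι ρ : Type*} [Fintype ι] [DecidableEq ι] [Fintype ρ] [DecidableEq ρ]
    (M : ρ → ι → ℤ) (k : ℕ) (hk : 1 ≤ k) (hcol : ∀ t, ∑ r, |M r t| ≤ k) (s : ℕ) :
    ∀ x : ι → ℚ, (Finset.univ.filter fun t => x t ≠ 0).card = s → (∀ t, 0 ≤ x t) → x ≠ 0 →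
      (∀ r, ∑ t, (M r t : ℚ) * x t = 0) →
      ∃ g : ι → ℕ, g ≠ 0 ∧ (∀ r, ∑ t, M r t * (g t : ℤ) = 0) ∧ (∀ t, x t = 0 → g t = 0) ∧
        ∑ t, g t ≤ (Fintype.card ρ + 1) * k ^ Fintype.card ρ := by
  classical
  induction s using Nat.strong_induction_on with
  | _ s ih =>
  intro x hs hpos hne hsol
  obtain ⟨t0, ht0⟩ := Function.ne_iff.mp hne
  simp only [Pi.zero_apply] at ht0
  set T0 := Finset.univ.filter fun t => x t ≠ 0 with hT0
  set T := T0.erase t0 with hT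
  have hT0mem : ∀ t, t ∈ T0 ↔ x t ≠ 0 := by simp [hT0]
  have ht0T : t0 ∈ T0 := (hT0mem _).2 ht0
  by_cases hli : LinearIndepOn ℚ (fun t => (fun r => (M r t : ℚ) : ρ → ℚ)) (T : Set ι)
  · have hx' : ∀ r, ∑ t ∈ T, (M r t : ℚ) * x t = - (M r t0 * x t0) := by
      intro r
      have h1 : ∑ t ∈ T0, (M r t : ℚ) * x t = 0 := by
        rw [← hsol r]
        apply Finset.sum_subset (Finset.subset_univ _)
        intro t _ ht
        rw [hT0mem, not_not] at ht
        simp [ht]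
      rw [← Finset.add_sum_erase _ _ ht0T] at h1
      linarith
    obtain ⟨D, hD0, hDk, hD⟩ := cramer_step_s12 M k hk hcol T t0 hli x hx'
    choose! y hyk hy using hD
    have hx0 : 0 < x t0 := lt_of_le_of_ne (hpos _) (Ne.symm ht0)
    have hTcard : T.card ≤ Fintype.card ρ := by
      have := hli.linearIndependent.fintype_card_le_finrank
      simpa using this
    let g : ι → ℕ := fun t => if t = t0 then D else if t ∈ T then (y t).natAbs else 0
    have hg : ∀ t, (g t : ℚ) = D / x t0 * x t := by
      intro t
      by_cases h : t = t0
      · subst h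
        simp only [g, if_true]
        field_simp
      · by_cases h2 : t ∈ T
        · have := hy t h2
          rw [abs_mul, abs_of_pos hx0, abs_of_nonneg (hpos t)] at this
          simp only [g, h, h2, if_true, if_false, Nat.cast_natAbs, Int.cast_abs]
          field_simp
          linarith
        · have : x t = 0 := by
            by_contra h3
            exact h2 (Finset.mem_erase.2 ⟨h, (hT0mem t).2 h3⟩)
          simp [g, h, h2, this]
    refine ⟨g, ?_, ?_, ?_, ?_⟩
    · intro h
      have := congrFun h t0
      simp only [g, if_true, Pi.zero_apply] at this
      omega
    · intro r
      have : ((∑ t, M r t * (g t : ℤ) : ℤ) : ℚ) = 0 := by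
        push_cast
        have : ∑ t, (M r t : ℚ) * (g t : ℚ) = D / x t0 * ∑ t, (M r t : ℚ) * x t := by
          rw [Finset.mul_sum]
          refine Finset.sum_congr rfl fun t _ => ?_
          rw [hg]; ring
        rw [this, hsol, mul_zero]
      exact_mod_cast this
    · intro t h
      have := hg t
      rw [h, mul_zero] at this
      exact_mod_cast this
    · have h1 : ∑ t, g t = ∑ t ∈ T0, g t := by
        symm
        apply Finset.sum_subset (Finset.subset_univ _)
        intro t _ ht
        rw [hT0mem, not_not] at ht
        have := hg t
        rw [ht, mul_zero] at this
        exact_mod_cast this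
      rw [h1, ← Finset.add_sum_erase _ _ ht0T]
      have h2 : ∑ t ∈ T0.erase t0, g t ≤ T.card * k ^ Fintype.card ρ := by
        apply Finset.sum_le_card_nsmul
        intro t ht
        have hne : t ≠ t0 := (Finset.mem_erase.1 ht).1
        have := hyk t ht
        simp only [g, hne, if_false]
        rw [if_pos ht]
        zify
        exact this
      have h3 : g t0 ≤ k ^ Fintype.card ρ := by simpa [g] using hDk
      calc _ ≤ k ^ Fintype.card ρ + T.card * k ^ Fintype.card ρ := Nat.add_le_add h3 h2
        _ ≤ k ^ Fintype.card ρ + Fintype.card ρ * k ^ Fintype.card ρ := by gcongr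
        _ = _ := by ring
  · -- dependent: reduce the support
    have hz : ∃ z : ι → ℚ, (∀ r, ∑ t, (M r t : ℚ) * z t = 0) ∧ (∀ t, t ∉ T → z t = 0) ∧
        ∃ t, 0 < z t := by
      have h1 : ∃ f : ι → ℚ, ∑ t ∈ T, f t • (fun r => (M r t : ℚ) : ρ → ℚ) = 0 ∧
          ∃ t ∈ T, f t ≠ 0 := by
        have := mt linearIndepOn_finset_iff.2 hli
        push Not at this
        exact this
      obtain ⟨f, hf, t1, ht1, hft1⟩ := h1
      let z : ι → ℚ := fun t => if t ∈ T then f t else 0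
      have hz1 : ∀ r, ∑ t, (M r t : ℚ) * z t = 0 := by
        intro r
        have := congrFun hf r
        simp only [Finset.sum_apply, Pi.smul_apply, smul_eq_mul, Pi.zero_apply] at this
        simp only [z, mul_ite, mul_zero]
        rw [Finset.sum_ite_mem, Finset.univ_inter, ← this]
        exact Finset.sum_congr rfl fun t _ => by ring
      have hz2 : ∀ t, t ∉ T → z t = 0 := fun t ht => by simp [z, ht]
      have hz3 : z t1 ≠ 0 := by simpa [z, ht1] using hft1
      rcases lt_or_gt_of_ne hz3 with h | h
      · exact ⟨fun t => - z t, fun r => by simp [hz1], fun t ht => by simp [hz2 t ht],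
          t1, by simpa using h⟩
      · exact ⟨z, hz1, hz2, t1, h⟩
    obtain ⟨z, hz1, hz2, t1, ht1⟩ := hz
    obtain ⟨t2, ht2, hmin⟩ := Finset.exists_min_image (Finset.univ.filter fun t => 0 < z t)
      (fun t => x t / z t) ⟨t1, by simpa using ht1⟩
    simp only [Finset.mem_filter, Finset.mem_univ, true_and] at ht2 hmin
    set l := x t2 / z t2 with hl
    have hl0 : 0 ≤ l := div_nonneg (hpos _) ht2.le
    let x' : ι → ℚ := fun t => x t - l * z t
    have hx't2 : x' t2 = 0 := by
      simp only [x', hl]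
      field_simp
      ring
    have hsub : ∀ t, x t = 0 → x' t = 0 := by
      intro t ht
      have : t ∉ T := by
        intro h
        exact (hT0mem t).1 (Finset.mem_of_mem_erase h) ht
      simp [x', ht, hz2 t this]
    have ht2T : t2 ∈ T := by
      by_contra h
      rw [hz2 t2 h] at ht2
      exact lt_irrefl _ ht2
    have hlt : (Finset.univ.filter fun t => x' t ≠ 0).card < s := by
      rw [← hs]
      apply Finset.card_lt_card
      refine ⟨?_, ?_⟩
      · intro t ht
        simp only [Finset.mem_filter, Finset.mem_univ, true_and] at ht
        rw [hT0mem]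
        exact fun h => ht (hsub t h)
      · intro h
        have := h (Finset.mem_of_mem_erase ht2T)
        simp [hx't2] at this
    have hp' : ∀ t, 0 ≤ x' t := by
      intro t
      simp only [x', sub_nonneg]
      by_cases h : 0 < z t
      · have := hmin t h
        rwa [le_div_iff₀ h] at this
      · exact le_trans (mul_nonpos_of_nonneg_of_nonpos hl0 (not_lt.1 h)) (hpos t)
    have hn' : x' ≠ 0 := by
      intro h
      have := congrFun h t0
      simp only [x', hz2 t0 (by simp [hT]), Pi.zero_apply, mul_zero, sub_zero] at this
      exact ht0 this
    have hs' : ∀ r, ∑ t, (M r t : ℚ) * x' t = 0 := by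
      intro r
      have : ∑ t, (M r t : ℚ) * x' t
          = ∑ t, (M r t : ℚ) * x t - l * ∑ t, (M r t : ℚ) * z t := by
        rw [Finset.mul_sum, ← Finset.sum_sub_distrib]
        exact Finset.sum_congr rfl fun t _ => by simp only [x']; ring
      rw [this, hsol, hz1]; ring
    obtain ⟨g, hg1, hg2, hg3, hg4⟩ := ih _ hlt x' rfl hp' hn' hs'
    exact ⟨g, hg1, hg2, fun t ht => hg3 t (hsub t ht), hg4⟩

lemma indec_bound {ι ρ : Type*} [Fintype ι] [DecidableEq ι] [Fintype ρ] [DecidableEq ρ]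
    (M : ρ → ι → ℤ) (k : ℕ) (hk : 1 ≤ k) (hcol : ∀ t, ∑ r, |M r t| ≤ k)
    (x : ι → ℕ) (hx : ∀ r, ∑ t, M r t * (x t : ℤ) = 0)
    (hind : ∀ y : ι → ℕ, y ≤ x → (∀ r, ∑ t, M r t * (y t : ℤ) = 0) → y ≠ 0 → y = x) :
    ∑ t, x t ≤ Fintype.card ι * ((Fintype.card ρ + 1) * k ^ Fintype.card ρ) := by
  classical
  set B := (Fintype.card ρ + 1) * k ^ Fintype.card ρ with hB
  by_contra hcon
  have hxB : B < ∑ t, x t ∨ Fintype.card ι = 0 := by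
    rcases Nat.eq_zero_or_pos (Fintype.card ι) with h | h
    · exact Or.inr h
    · left
      push Not at hcon
      exact lt_of_le_of_lt (Nat.le_mul_of_pos_left _ h) hcon
  rcases hxB with hxB | h0
  swap
  · have := Fintype.card_eq_zero_iff.1 h0
    apply hcon
    simp
  have key : ∀ s : ℕ, ∀ w : ι → ℚ, (Finset.univ.filter fun t => w t ≠ 0).card = s →
      (∀ t, 0 ≤ w t) → (∀ t, w t ≤ x t) → (∀ r, ∑ t, (M r t : ℚ) * w t = 0) →
      ∑ t, w t ≤ s * B := by
    intro s
    induction s using Nat.strong_induction_on with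
    | _ s ih =>
    intro w hs hpos hle hsol
    by_cases hw : w = 0
    · subst hw
      simp only [Pi.zero_apply, Finset.sum_const_zero]
      positivity
    obtain ⟨g, hg0, hgs, hgz, hgB⟩ := circuit M k hk hcol s w hs hpos hw hsol
    obtain ⟨t1, ht1⟩ := Function.ne_iff.mp hg0
    obtain ⟨t2, ht2, hmin⟩ := Finset.exists_min_image (Finset.univ.filter fun t => g t ≠ 0)
      (fun t => w t / (g t : ℚ)) ⟨t1, by simpa using ht1⟩
    simp only [Finset.mem_filter, Finset.mem_univ, true_and] at ht2 hmin
    set l := w t2 / (g t2 : ℚ) with hl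
    have hl0 : 0 ≤ l := div_nonneg (hpos _) (Nat.cast_nonneg _)
    have hgpos : ∀ t, g t ≠ 0 → (0 : ℚ) < g t := fun t h => by
      exact_mod_cast Nat.pos_of_ne_zero h
    have hlg : ∀ t, l * g t ≤ w t := by
      intro t
      by_cases h : g t = 0
      · simp [h, hpos t]
      · have := hmin t h
        rwa [le_div_iff₀ (hgpos t h)] at this
    have hl1 : l < 1 := by
      by_contra h
      push Not at h
      have hgx : g ≤ x := by
        intro t
        have : (g t : ℚ) ≤ x t := by
          calc (g t : ℚ) ≤ l * g t := le_mul_of_one_le_left (Nat.cast_nonneg _) h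
            _ ≤ w t := hlg t
            _ ≤ x t := hle t
        exact_mod_cast this
      have := hind g hgx hgs hg0
      rw [this] at hgB
      omega
    let w' : ι → ℚ := fun t => w t - l * g t
    have hw't2 : w' t2 = 0 := by
      have := hgpos t2 ht2
      simp only [w', hl]
      field_simp
      ring
    have hwt2 : w t2 ≠ 0 := fun h => ht2 (hgz t2 h)
    have hlt : (Finset.univ.filter fun t => w' t ≠ 0).card < s := by
      rw [← hs]
      apply Finset.card_lt_card
      refine ⟨?_, ?_⟩
      · intro t ht
        simp only [Finset.mem_filter, Finset.mem_univ, true_and] at ht ⊢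
        intro h
        apply ht
        simp [w', h, hgz t h]
      · intro h
        have := h (show t2 ∈ _ by simpa using hwt2)
        simp [hw't2] at this
    have h1 := ih _ hlt w' rfl (fun t => sub_nonneg.2 (hlg t))
      (fun t => le_trans (sub_le_self _ (mul_nonneg hl0 (Nat.cast_nonneg _))) (hle t)) ?_
    · have h2 : ∑ t, w t = ∑ t, w' t + l * ∑ t, (g t : ℚ) := by
        rw [Finset.mul_sum, ← Finset.sum_add_distrib]
        exact Finset.sum_congr rfl fun t _ => by simp only [w']; ring
      have h3 : (∑ t, (g t : ℚ)) ≤ B := by exact_mod_cast hgB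
      have h4 : (0 : ℚ) ≤ ∑ t, (g t : ℚ) := Finset.sum_nonneg fun t _ => Nat.cast_nonneg _
      have h5 : l * ∑ t, (g t : ℚ) ≤ B := by nlinarith
      have h6 : (((Finset.univ.filter fun t => w' t ≠ 0).card : ℕ) : ℚ) + 1 ≤ s := by
        exact_mod_cast hlt
      have h7 : (0 : ℚ) ≤ B := Nat.cast_nonneg _
      nlinarith
    · intro r
      have h2 : ∑ t, (M r t : ℚ) * w' t
          = ∑ t, (M r t : ℚ) * w t - l * ((∑ t, M r t * (g t : ℤ) : ℤ) : ℚ) := by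
        push_cast
        rw [Finset.mul_sum, ← Finset.sum_sub_distrib]
        exact Finset.sum_congr rfl fun t _ => by simp only [w']; ring
      rw [h2, hsol, hgs]; simp
  have h := key _ (fun t => (x t : ℚ)) rfl (fun t => Nat.cast_nonneg _) (fun t => le_rfl)
    (fun r => by exact_mod_cast hx r)
  apply hcon
  have h2 : (((Finset.univ.filter fun t => (x t : ℚ) ≠ 0).card : ℕ) : ℚ) ≤ Fintype.card ι := by
    exact_mod_cast Finset.card_le_univ _
  have h7 : (0 : ℚ) ≤ B := Nat.cast_nonneg _
  have h8 : (∑ t, (x t : ℚ)) ≤ Fintype.card ι * B := by nlinarith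
  exact_mod_cast h8

lemma exists_matching {Δ E : Type*} [Fintype Δ] [Fintype E] [DecidableEq E]
    (ty : Δ → E) (σ : E → E)
    (hσ : ∀ e, σ (σ e) = e)
    (hcard : ∀ e, Fintype.card {x // ty x = e} = Fintype.card {x // ty x = σ e}) :
    ∃ τ : Δ → Δ, (∀ x, τ (τ x) = x) ∧ ∀ x, ty (τ x) = σ (ty x) := by
  classical
  let r := Fintype.equivFin E
  let φ : ∀ e, {x // ty x = e} ≃ {x // ty x = σ e} := fun e => Fintype.equivOfCardEq (hcard e)
  let τ : Δ → Δ := fun x =>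
    if σ (ty x) = ty x then x
    else if r (ty x) < r (σ (ty x)) then (φ (ty x) ⟨x, rfl⟩).1
    else ((φ (σ (ty x))).symm ⟨x, (hσ _).symm⟩).1
  have hty : ∀ x, ty (τ x) = σ (ty x) := by
    intro x
    simp only [τ]
    split_ifs with h1 h2
    · exact h1.symm
    · exact (φ (ty x) ⟨x, rfl⟩).2
    · exact ((φ (σ (ty x))).symm ⟨x, (hσ _).symm⟩).2
  refine ⟨τ, ?_, hty⟩
  intro x
  by_cases h1 : σ (ty x) = ty x
  · have : τ x = x := by simp [τ, h1]
    rw [this, this]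
  have hne : r (σ (ty x)) ≠ r (ty x) := fun h => h1 (r.injective h)
  have hy1 := hty x
  generalize hy : τ x = y at hy1
  have h1' : ¬ σ (ty y) = ty y := by
    rw [hy1, hσ]; exact fun h => h1 h.symm
  by_cases h2 : r (ty x) < r (σ (ty x))
  · have h2' : ¬ r (ty y) < r (σ (ty y)) := by
      rw [hy1, hσ]; exact not_lt.2 h2.le
    have e1 : τ x = (φ (ty x) ⟨x, rfl⟩).1 := by simp only [τ, if_neg h1, if_pos h2]
    have e2 : τ y = ((φ (σ (ty y))).symm ⟨y, (hσ _).symm⟩).1 := by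
      simp only [τ, if_neg h1', if_neg h2']
    rw [e2]
    have key : ∀ e (_ : e = ty x) (h : ty y = σ e), ((φ e).symm ⟨y, h⟩).1 = x := by
      rintro _ rfl h
      have : (⟨y, h⟩ : {z // ty z = σ (ty x)}) = φ (ty x) ⟨x, rfl⟩ := by
        apply Subtype.ext
        rw [← e1, hy]
      rw [this]; simp
    exact key _ (by rw [hy1, hσ]) _
  · have h2' : r (ty y) < r (σ (ty y)) := by
      rw [hy1, hσ]; exact lt_of_le_of_ne (not_lt.1 h2) hne
    have e1 : τ x = ((φ (σ (ty x))).symm ⟨x, (hσ _).symm⟩).1 := by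
      simp only [τ, if_neg h1, if_neg h2]
    have e2 : τ y = (φ (ty y) ⟨y, rfl⟩).1 := by simp only [τ, if_neg h1', if_pos h2']
    rw [e2]
    have key : ∀ e (_ : e = σ (ty x)) (h : ty y = e), (φ e ⟨y, h⟩).1 = x := by
      rintro _ rfl h
      have : (⟨y, h⟩ : {z // ty z = σ (ty x)}) = (φ (σ (ty x))).symm ⟨x, (hσ _).symm⟩ := by
        apply Subtype.ext
        rw [← e1, hy]
      rw [this]; simp
    exact key _ hy1 _

/-- Edge-based form of the step relation. -/
lemma step_iff {S : Signature} (A : GWA S) (G : SigGraph S) (c c' : A.Q × Fin G.n) :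
    A.Step G c c' ↔ ∃ q' d, A.δ (c.1, G.lab c.2) = some (q', d) ∧
      G.edge c.2 d = some c'.2 ∧ c'.1 = q' := by
  constructor
  · rintro ⟨q', d, h, h1, rfl⟩
    exact ⟨q', d, h1, by simp [SigGraph.nbr], rfl⟩
  · rintro ⟨q', d, h1, h2, rfl⟩
    refine ⟨c'.1, d, A.δ_dir _ _ _ h1, h1, ?_⟩
    simp [SigGraph.nbr, h2]

lemma step_det {S : Signature} (A : GWA S) (G : SigGraph S) {c c1 c2 : A.Q × Fin G.n}
    (h1 : A.Step G c c1) (h2 : A.Step G c c2) : c1 = c2 := by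
  rw [step_iff] at h1 h2
  obtain ⟨q1, d1, a1, b1, e1⟩ := h1
  obtain ⟨q2, d2, a2, b2, e2⟩ := h2
  rw [a1] at a2
  simp only [Option.some.injEq, Prod.mk.injEq] at a2
  obtain ⟨rfl, rfl⟩ := a2
  rw [b1] at b2
  ext1
  · rw [e1, e2]
  · exact Option.some.inj b2

/-- Certificate of acceptance: a set of configurations. -/
structure Cert {S : Signature} (A : GWA S) (G : SigGraph S) (M : Set (A.Q × Fin G.n)) : Prop where
  start : (A.q0, G.v0) ∈ M
  next : ∀ c ∈ M, (c.1, G.lab c.2) ∈ A.F ∨ ∃ c' ∈ M, A.Step G c c'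
  inj : ∀ c1 ∈ M, ∀ c2 ∈ M, ∀ c, A.Step G c1 c → A.Step G c2 c → c1 = c2
  nohit : ∀ c ∈ M, ¬ A.Step G c (A.q0, G.v0)

lemma Cert.accepts {S : Signature} {A : GWA S} {G : SigGraph S} {M : Set (A.Q × Fin G.n)}
    (h : Cert A G M) : A.Accepts G := by
  by_contra hcon
  have hr : ∀ c, Relation.ReflTransGen (A.Step G) (A.q0, G.v0) c →
      c ∈ M ∧ ∃ c' ∈ M, A.Step G c c' := by
    intro c hc
    induction hc with
    | refl =>
      refine ⟨h.start, (h.next _ h.start).resolve_left fun hF => hcon ⟨_, .refl, hF⟩⟩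
    | tail h1 h2 ih =>
      rename_i b c
      obtain ⟨_, c', hc', hs⟩ := ih
      have := step_det A G h2 hs
      subst this
      exact ⟨hc', (h.next _ hc').resolve_left fun hF => hcon ⟨_, h1.tail h2, hF⟩⟩
  let R := {c // Relation.ReflTransGen (A.Step G) (A.q0, G.v0) c}
  have hnext : ∀ c : R, ∃ c' : R, A.Step G c.1 c'.1 := by
    intro c
    obtain ⟨_, c', _, hs⟩ := hr c.1 c.2
    exact ⟨⟨c', c.2.tail hs⟩, hs⟩
  choose f hf using hnext
  have hinj : Function.Injective f := by
    intro a b hab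
    apply Subtype.ext
    exact h.inj _ (hr _ a.2).1 _ (hr _ b.2).1 _ (hf a) (hab ▸ hf b)
  obtain ⟨c, hc⟩ := (Finite.injective_iff_surjective.1 hinj) ⟨_, .refl⟩
  have := hf c
  rw [hc] at this
  exact h.nohit _ (hr _ c.2).1 this

lemma exists_seq {α : Type*} {r : α → α → Prop} {a b : α} (h : Relation.ReflTransGen r a b) :
    ∃ (f : ℕ → α) (L : ℕ), f 0 = a ∧ f L = b ∧ ∀ i < L, r (f i) (f (i + 1)) := by
  induction h with
  | refl => exact ⟨fun _ => a, 0, rfl, rfl, by simp⟩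
  | tail h1 h2 ih =>
    rename_i b c
    obtain ⟨f, L, h0, hL, hs⟩ := ih
    refine ⟨fun i => if i ≤ L then f i else c, L + 1, by simpa using h0, by simp, ?_⟩
    intro i hi
    rcases Nat.lt_or_ge i L with h | h
    · have : i + 1 ≤ L := h
      simpa [h.le, this] using hs i h
    · have : i = L := by omega
      subst this
      simpa [hL] using h2

lemma exists_cert {S : Signature} {A : GWA S} {G : SigGraph S} (h : A.Accepts G) :
    ∃ M, Cert A G M := by
  obtain ⟨c, hc, hF⟩ := h
  obtain ⟨f, L, h0, hL, hs⟩ := exists_seq hc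
  have hterm : ∀ c', ¬ A.Step G c c' := by
    intro c' hc'
    obtain ⟨q', d, h1, _⟩ := (step_iff _ _ _ _).1 hc'
    exact A.δ_not_F _ _ _ h1 hF
  have hinj : ∀ i j, i < j → j ≤ L → f i ≠ f j := by
    intro i j hij hj heq
    have : ∀ m, j + m ≤ L → f (i + m) = f (j + m) := by
      intro m
      induction m with
      | zero => intro _; exact heq
      | succ m ih =>
        intro hm
        have e := ih (by omega)
        have s1 := hs (i + m) (by omega)
        have s2 := hs (j + m) (by omega)
        rw [e] at s1
        exact step_det A G s1 s2
    have e := this (L - j) (by omega)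
    have s1 := hs (i + (L - j)) (by omega)
    rw [e, show j + (L - j) = L by omega, hL] at s1
    exact hterm _ s1
  have hinj' : ∀ i j, i ≤ L → j ≤ L → f i = f j → i = j := by
    intro i j hi hj h
    rcases lt_trichotomy i j with h' | h' | h'
    · exact absurd h (hinj _ _ h' hj)
    · exact h'
    · exact absurd h.symm (hinj _ _ h' hi)
  have hstep : ∀ i ≤ L, ∀ c', A.Step G (f i) c' → i < L ∧ c' = f (i + 1) := by
    intro i hi c' hc'
    rcases Nat.lt_or_ge i L with h | h
    · exact ⟨h, step_det A G hc' (hs i h)⟩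
    · have : i = L := by omega
      subst this
      rw [hL] at hc'
      exact absurd hc' (hterm _)
  refine ⟨{c | ∃ i ≤ L, f i = c}, ⟨0, by omega, h0⟩, ?_, ?_, ?_⟩
  · rintro _ ⟨i, hi, rfl⟩
    rcases Nat.lt_or_ge i L with h | h
    · exact Or.inr ⟨_, ⟨i + 1, h, rfl⟩, hs i h⟩
    · have : i = L := by omega
      subst this
      left; rw [hL]; exact hF
  · rintro _ ⟨i, hi, rfl⟩ _ ⟨j, hj, rfl⟩ c hi' hj'
    obtain ⟨hi1, rfl⟩ := hstep i hi _ hi'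
    obtain ⟨hj1, hj2⟩ := hstep j hj _ hj'
    have := hinj' _ _ hi1 hj1 hj2
    rw [show i = j by omega]
  · rintro _ ⟨i, hi, rfl⟩ h
    obtain ⟨h1, h2⟩ := hstep i hi _ h
    rw [← h0] at h2
    have := hinj' _ _ (by omega) h1 h2
    omega

/-- Node types. -/
abbrev NT (S : Signature) (A : GWA S) := S.Lab × (S.D → Finset A.Q × Finset A.Q)

/-- Edge types. -/
abbrev ET (S : Signature) (A : GWA S) := S.D × Finset A.Q × Finset A.Q

/-- Reversal of edge types. -/
def esym {S : Signature} {A : GWA S} (e : ET S A) : ET S A := (S.neg e.1, e.2.2, e.2.1)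

lemma esym_esym {S : Signature} {A : GWA S} (e : ET S A) : esym (esym e) = e := by
  simp [esym, S.neg_neg]

/-- Number of edges of type `e` at a node of type `t`. -/
def cnt {S : Signature} {A : GWA S} (t : NT S A) (e : ET S A) : ℕ :=
  if e.1 ∈ S.Da t.1 ∧ t.2 e.1 = e.2 then 1 else 0

/-- The states visited at a node type. -/
def Vis {S : Signature} {A : GWA S} (t : NT S A) (q : A.Q) : Prop :=
  (∃ d ∈ S.Da t.1, q ∈ (t.2 d).2) ∨ (t.1 ∈ S.init ∧ q = A.q0)

/-- Local consistency of a node type. -/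
structure NOK {S : Signature} {A : GWA S} (t : NT S A) : Prop where
  next : ∀ q, Vis t q → (q, t.1) ∈ A.F ∨ ∃ q' d, A.δ (q, t.1) = some (q', d) ∧ q' ∈ (t.2 d).1
  inj : ∀ q1 q2 p, Vis t q1 → Vis t q2 → A.δ (q1, t.1) = some p → A.δ (q2, t.1) = some p → q1 = q2
  disj : ∀ q, ∀ d ∈ S.Da t.1, ∀ d' ∈ S.Da t.1, q ∈ (t.2 d).2 → q ∈ (t.2 d').2 → d = d'
  nohit : t.1 ∈ S.init → ∀ d ∈ S.Da t.1, A.q0 ∉ (t.2 d).2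

lemma accepts_of_marking {S : Signature} {A : GWA S} (G : SigGraph S) (ty : Fin G.n → NT S A)
    (hlab : ∀ v, (ty v).1 = G.lab v) (hok : ∀ v, NOK (ty v))
    (hedge : ∀ v d u, G.edge v d = some u → (ty u).2 (S.neg d) = ((ty v).2 d).swap) :
    A.Accepts G := by
  have hdom : ∀ v d u, G.edge v d = some u → d ∈ S.Da (ty v).1 := by
    intro v d u h
    rw [hlab, ← G.edge_dom, h]; rfl
  -- a marked step enters by the marked direction
  have hstep : ∀ c c', Vis (ty c.2) c.1 → A.Step G c c' → ∃ d,
      A.δ (c.1, G.lab c.2) = some (c'.1, d) ∧ G.edge c.2 d = some c'.2 ∧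
      S.neg d ∈ S.Da (ty c'.2).1 ∧ c'.1 ∈ ((ty c'.2).2 (S.neg d)).2 := by
    intro c c' hv hs
    obtain ⟨q', d, h1, h2, h3⟩ := (step_iff _ _ _ _).1 hs
    subst h3
    refine ⟨d, h1, h2, hdom _ _ _ (G.edge_sym _ _ _ h2), ?_⟩
    rw [hedge _ _ _ h2]
    rcases (hok c.2).next _ hv with h | ⟨q'', d', h, h'⟩
    · rw [hlab] at h
      exact absurd h (A.δ_not_F _ _ _ h1)
    · rw [hlab, h1] at h
      simp only [Option.some.injEq, Prod.mk.injEq] at h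
      obtain ⟨rfl, rfl⟩ := h
      exact h'
  refine Cert.accepts (M := {c | Vis (ty c.2) c.1}) ⟨?_, ?_, ?_, ?_⟩
  · right
    exact ⟨by rw [hlab, G.init_iff], rfl⟩
  · intro c hc
    rcases (hok c.2).next _ hc with h | ⟨q', d, h, h'⟩
    · left; rwa [hlab] at h
    · right
      rw [hlab] at h
      obtain ⟨u, hu⟩ := Option.isSome_iff_exists.1 ((G.edge_dom c.2 d).2 (A.δ_dir _ _ _ h))
      have hs : A.Step G c (q', u) := (step_iff _ _ _ _).2 ⟨q', d, h, hu, rfl⟩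
      obtain ⟨d', _, _, h3, h4⟩ := hstep c _ hc hs
      exact ⟨(q', u), Or.inl ⟨_, h3, h4⟩, hs⟩
  · intro c1 hc1 c2 hc2 c h1 h2
    obtain ⟨d1, a1, b1, e1, f1⟩ := hstep _ _ hc1 h1
    obtain ⟨d2, a2, b2, e2, f2⟩ := hstep _ _ hc2 h2
    have hd := (hok c.2).disj _ _ e1 _ e2 f1 f2
    have s1 := G.edge_sym _ _ _ b1
    have s2 := G.edge_sym _ _ _ b2
    rw [hd, s2] at s1
    have hv : c2.2 = c1.2 := Option.some.inj s1
    have hd' : d1 = d2 := by rw [← S.neg_neg d1, hd, S.neg_neg]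
    subst hd'
    have hq := (hok c1.2).inj c1.1 c2.1 (c.1, d1) hc1 (by rw [← hv]; exact hc2)
      (by rw [hlab]; exact a1) (by rw [hlab, ← hv]; exact a2)
    exact Prod.ext hq hv.symm
  · intro c hc hs
    obtain ⟨d1, a1, b1, e1, f1⟩ := hstep _ _ hc hs
    exact (hok _).nohit (by rw [hlab, G.init_iff]) _ e1 f1

lemma exists_marking {S : Signature} {A : GWA S} (G : SigGraph S) (h : A.Accepts G) :
    ∃ ty : Fin G.n → NT S A, (∀ v, (ty v).1 = G.lab v) ∧ (∀ v, NOK (ty v)) ∧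
      ∀ v d u, G.edge v d = some u → (ty u).2 (S.neg d) = ((ty v).2 d).swap := by
  classical
  obtain ⟨M, hM⟩ := exists_cert h
  let X : Fin G.n → S.D → Finset A.Q := fun v d =>
    Finset.univ.filter fun q' => ∃ q, (q, v) ∈ M ∧ A.δ (q, G.lab v) = some (q', d)
  let Y : Fin G.n → S.D → Finset A.Q := fun v d =>
    match G.edge v d with
    | some u => X u (S.neg d)
    | none => ∅
  have hX : ∀ v d q', q' ∈ X v d ↔ ∃ q, (q, v) ∈ M ∧ A.δ (q, G.lab v) = some (q', d) := by
    intro v d q'; simp [X]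
  have hYe : ∀ v d u, G.edge v d = some u → Y v d = X u (S.neg d) := by
    intro v d u h; simp only [Y, h]
  let ty : Fin G.n → NT S A := fun v => (G.lab v, fun d => (X v d, Y v d))
  have hY : ∀ v d q', d ∈ S.Da (G.lab v) → q' ∈ Y v d → ∃ u q, (q, u) ∈ M ∧
      A.δ (q, G.lab u) = some (q', S.neg d) ∧ A.Step G (q, u) (q', v) := by
    intro v d q' hd hq
    obtain ⟨u, hu⟩ := Option.isSome_iff_exists.1 ((G.edge_dom v d).2 hd)
    rw [hYe _ _ _ hu, hX] at hq
    obtain ⟨q, h1, h2⟩ := hq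
    exact ⟨u, q, h1, h2, (step_iff _ _ _ _).2 ⟨q', _, h2, G.edge_sym _ _ _ hu, rfl⟩⟩
  have hVis : ∀ v q, Vis (ty v) q → (q, v) ∈ M := by
    rintro v q (⟨d, hd, hq⟩ | ⟨hi, rfl⟩)
    · obtain ⟨u, q1, h1, h2, h3⟩ := hY v d q hd hq
      rcases hM.next _ h1 with hF | ⟨c', hc', hs⟩
      · exact absurd hF (A.δ_not_F _ _ _ h2)
      · rwa [step_det A G h3 hs]
    · have : v = G.v0 := (G.init_iff v).1 hi
      subst this
      exact hM.start
  refine ⟨ty, fun _ => rfl, ?_, ?_⟩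
  · intro v
    refine ⟨?_, ?_, ?_, ?_⟩
    · intro q hq
      have hm := hVis v q hq
      rcases hM.next _ hm with hF | ⟨c', hc', hs⟩
      · exact Or.inl hF
      · right
        obtain ⟨q', d, h1, h2, h3⟩ := (step_iff _ _ _ _).1 hs
        exact ⟨q', d, h1, (hX _ _ _).2 ⟨q, hm, h1⟩⟩
    · intro q1 q2 p h1 h2 e1 e2
      obtain ⟨u, hu⟩ := Option.isSome_iff_exists.1 ((G.edge_dom v p.2).2 (A.δ_dir _ _ _ e1))
      have := hM.inj _ (hVis v q1 h1) _ (hVis v q2 h2) (p.1, u)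
        ((step_iff _ _ _ _).2 ⟨p.1, p.2, e1, hu, rfl⟩)
        ((step_iff _ _ _ _).2 ⟨p.1, p.2, e2, hu, rfl⟩)
      exact congrArg Prod.fst this
    · intro q d hd d' hd' h1 h2
      obtain ⟨u1, q1, a1, b1, s1⟩ := hY v d q hd h1
      obtain ⟨u2, q2, a2, b2, s2⟩ := hY v d' q hd' h2
      have := hM.inj _ a1 _ a2 _ s1 s2
      simp only [Prod.mk.injEq] at this
      obtain ⟨rfl, rfl⟩ := this
      rw [b1] at b2
      simp only [Option.some.injEq, Prod.mk.injEq, true_and] at b2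
      rw [← S.neg_neg d, b2, S.neg_neg]
    · intro hi d hd hq
      have : v = G.v0 := (G.init_iff v).1 hi
      subst this
      obtain ⟨u1, q1, a1, b1, s1⟩ := hY _ d _ hd hq
      exact hM.nohit _ a1 s1
  · intro v d u h
    have h' := G.edge_sym _ _ _ h
    simp only [ty, Prod.swap, hYe _ _ _ h, hYe _ _ _ h', S.neg_neg]

lemma build {S : Signature} {A : GWA S} (g : NT S A → ℕ) (hok : ∀ t, g t ≠ 0 → NOK t)
    (hbal : ∀ e : ET S A, ∑ t, g t * cnt t e = ∑ t, g t * cnt t (esym e))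
    (hinit : ∑ t : NT S A, g t * (if t.1 ∈ S.init then 1 else 0) = 1) :
    ∃ G : SigGraph S, A.Accepts G ∧ G.n = ∑ t, g t := by
  classical
  have hN : Fintype.card (Σ t : NT S A, Fin (g t)) = ∑ t, g t := by simp
  generalize ∑ t, g t = N at hN
  let eqv : Fin N ≃ (Σ t : NT S A, Fin (g t)) := (Fintype.equivFinOfCardEq hN).symm
  let ty : Fin N → NT S A := fun v => (eqv v).1
  have hok' : ∀ v, NOK (ty v) := by
    intro v
    apply hok
    have := (eqv v).2.2
    intro h
    have h' : g (eqv v).1 = 0 := h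
    omega
  have hsum : ∀ f : NT S A → ℕ, ∑ v, f (ty v) = ∑ t, g t * f t := by
    intro f
    have : ∑ v, f (ty v) = ∑ p : (Σ t : NT S A, Fin (g t)), f p.1 :=
      Equiv.sum_comp eqv (fun p => f p.1)
    rw [this, Fintype.sum_sigma]
    simp
  -- the initial node
  have hi1 : (Finset.univ.filter fun v => (ty v).1 ∈ S.init).card = 1 := by
    rw [Finset.card_filter, hsum (fun t => if t.1 ∈ S.init then 1 else 0), hinit]
  obtain ⟨v0, hv0⟩ := Finset.card_eq_one.1 hi1
  have hv0' : ∀ v, (ty v).1 ∈ S.init ↔ v = v0 := by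
    intro v
    have := Finset.ext_iff.1 hv0 v
    simpa using this
  -- darts
  let Δ := {p : Fin N × S.D // p.2 ∈ S.Da (ty p.1).1}
  let dt : Δ → ET S A := fun p => (p.1.2, (ty p.1.1).2 p.1.2)
  have hfib : ∀ e, Fintype.card {x // dt x = e} = ∑ t, g t * cnt t e := by
    intro e
    rw [← hsum (fun t => cnt t e)]
    have : Fintype.card {x // dt x = e} =
        Fintype.card {v // e.1 ∈ S.Da (ty v).1 ∧ (ty v).2 e.1 = e.2} := by
      refine Fintype.card_congr ⟨fun x => ⟨x.1.1.1, ?_⟩, fun v => ⟨⟨(v.1, e.1), v.2.1⟩, ?_⟩, ?_, ?_⟩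
      · obtain ⟨⟨⟨v, d⟩, hd⟩, rfl⟩ := x
        exact ⟨hd, rfl⟩
      · exact Prod.ext rfl v.2.2
      · rintro ⟨⟨⟨v, d⟩, hd⟩, rfl⟩
        rfl
      · rintro ⟨v, hv⟩
        rfl
    rw [this, Fintype.card_subtype, Finset.card_filter]
    rfl
  obtain ⟨τ, hττ, hτt⟩ := exists_matching dt esym esym_esym (fun e => by rw [hfib, hfib, hbal])
  let edge : Fin N → S.D → Option (Fin N) := fun v d =>
    if h : d ∈ S.Da (ty v).1 then some (τ ⟨(v, d), h⟩).1.1 else none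
  have hedge : ∀ v d u, edge v d = some u → ∃ (h : d ∈ S.Da (ty v).1)
      (h' : S.neg d ∈ S.Da (ty u).1), τ ⟨(v, d), h⟩ = ⟨(u, S.neg d), h'⟩ := by
    intro v d u hu
    by_cases h : d ∈ S.Da (ty v).1
    · simp only [edge, h, dif_pos, Option.some.injEq] at hu
      have ht := congrArg Prod.fst (hτt ⟨(v, d), h⟩)
      simp only [dt, esym] at ht
      have : (τ ⟨(v, d), h⟩).1 = (u, S.neg d) := Prod.ext hu ht
      have h' := (τ ⟨(v, d), h⟩).2
      rw [this] at h'
      exact ⟨h, h', Subtype.ext this⟩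
    · simp [edge, h] at hu
  let G : SigGraph S :=
    { n := N
      v0 := v0
      edge := edge
      lab := fun v => (ty v).1
      edge_sym := by
        intro v d u hu
        obtain ⟨h, h', e⟩ := hedge v d u hu
        simp only [edge, h', dif_pos]
        rw [← e, hττ]
      edge_dom := by
        intro v d
        by_cases h : d ∈ S.Da (ty v).1 <;> simp [edge, h]
      init_iff := hv0' }
  refine ⟨G, accepts_of_marking G ty (fun _ => rfl) hok' ?_, rfl⟩
  intro v d u hu
  obtain ⟨h, h', e⟩ := hedge v d u hu
  have ht := congrArg Prod.snd (hτt ⟨(v, d), h⟩)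
  rw [e] at ht
  exact ht

lemma counts {S : Signature} {A : GWA S} (G : SigGraph S) (h : A.Accepts G) :
    ∃ g : NT S A → ℕ, (∀ t, g t ≠ 0 → NOK t) ∧
      (∀ e : ET S A, ∑ t, g t * cnt t e = ∑ t, g t * cnt t (esym e)) ∧
      ∑ t : NT S A, g t * (if t.1 ∈ S.init then 1 else 0) = 1 := by
  classical
  obtain ⟨ty, hlab, hok, hedge⟩ := exists_marking G h
  let g : NT S A → ℕ := fun t => (Finset.univ.filter fun v => ty v = t).card
  have hsum : ∀ f : NT S A → ℕ, ∑ t, g t * f t = ∑ v, f (ty v) := by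
    intro f
    simp only [g, Finset.card_filter, Finset.sum_mul, ite_mul, one_mul, zero_mul]
    rw [Finset.sum_comm]
    simp
  have hle : ∀ e : ET S A, ∑ v, cnt (ty v) e ≤ ∑ v, cnt (ty v) (esym e) := by
    intro e
    simp only [cnt]
    rw [← Finset.card_filter, ← Finset.card_filter]
    have hn : ∀ v, ∃ u, e.1 ∈ S.Da (ty v).1 → G.edge v e.1 = some u := by
      intro v
      by_cases hd : e.1 ∈ S.Da (ty v).1
      · rw [hlab, ← G.edge_dom] at hd
        obtain ⟨u, hu⟩ := Option.isSome_iff_exists.1 hd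
        exact ⟨u, fun _ => hu⟩
      · exact ⟨v, fun h => absurd h hd⟩
    choose nb hnb using hn
    apply Finset.card_le_card_of_injOn nb
    · intro v hv
      simp only [Finset.coe_filter, Finset.mem_univ, true_and, Set.mem_ofPred_eq] at hv ⊢
      have hu := hnb v hv.1
      have hu' := G.edge_sym _ _ _ hu
      refine ⟨?_, ?_⟩
      · rw [hlab, ← G.edge_dom]
        simp [esym, hu']
      · simp only [esym]
        rw [hedge _ _ _ hu, hv.2]
        rfl
    · intro v hv v' hv' hvv
      simp only [Finset.coe_filter, Finset.mem_univ, true_and, Set.mem_ofPred_eq] at hv hv'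
      have h1 := G.edge_sym _ _ _ (hnb v hv.1)
      have h2 := G.edge_sym _ _ _ (hnb v' hv'.1)
      rw [hvv, h2] at h1
      exact (Option.some.inj h1).symm
  refine ⟨g, ?_, ?_, ?_⟩
  · intro t ht
    obtain ⟨v, hv⟩ := Finset.card_pos.1 (Nat.pos_of_ne_zero ht)
    simp only [Finset.mem_filter, Finset.mem_univ, true_and] at hv
    rw [← hv]; exact hok v
  · intro e
    rw [hsum, hsum]
    apply le_antisymm (hle e)
    have := hle (esym e)
    rwa [esym_esym] at this
  · rw [hsum (fun t => if t.1 ∈ S.init then 1 else 0)]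
    simp only [hlab, G.init_iff]
    simp

lemma sum_bound_aux {E : Type*} [Fintype E] [DecidableEq E] {N : ℕ} (r : E ≃ Fin N) (σ : E → E)
    (hσ : ∀ e, σ (σ e) = e) (f : E → ℕ) :
    ∑ e : {e // r e < r (σ e)}, (f e + f (σ e)) ≤ ∑ e, f e := by
  classical
  rw [Finset.sum_add_distrib]
  have h1 : ∑ e : {e // r e < r (σ e)}, f e =
      ∑ e ∈ Finset.univ.filter (fun e => r e < r (σ e)), f e := by
    rw [Finset.sum_subtype (Finset.univ.filter (fun e => r e < r (σ e)))
      (p := fun e => r e < r (σ e)) (by simp) f]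
  have h2 : ∑ e : {e // r e < r (σ e)}, f (σ e) =
      ∑ e ∈ Finset.univ.filter (fun e => r (σ e) < r e), f e := by
    have : ∑ e : {e // r e < r (σ e)}, f (σ e) =
        ∑ e ∈ Finset.univ.filter (fun e => r e < r (σ e)), f (σ e) := by
      rw [Finset.sum_subtype (Finset.univ.filter (fun e => r e < r (σ e)))
        (p := fun e => r e < r (σ e)) (by simp) (fun e => f (σ e))]
    rw [this]
    refine Finset.sum_nbij' σ σ ?_ ?_ ?_ ?_ ?_ <;> simp [hσ]
  rw [h1, h2, ← Finset.sum_union]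
  · exact Finset.sum_le_sum_of_subset (Finset.subset_univ _)
  · rw [Finset.disjoint_filter]
    intro e _ h h'
    exact absurd h (lt_asymm h')

/-- If a graph-walking automaton with `n` states over a signature with `k ≥ 2` directions,
`m` node labels and all `D_a` non-empty accepts at least one graph, then it accepts a graph
with at most `m·4^(n(k+1))·k^(k·4^n − 1)` nodes. -/
theorem stmt12 (S : Signature) (A : GWA S)
    (hD : 2 ≤ Fintype.card S.D) (hDa : ∀ a : S.Lab, (S.Da a).Nonempty)
    (n k m : ℕ)
    (hn : Fintype.card A.Q = n) (hk : Fintype.card S.D = k)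
    (hm : Fintype.card S.Lab = m)
    (hacc : ∃ G : SigGraph S, A.Accepts G) :
    ∃ G : SigGraph S, A.Accepts G ∧
      G.n ≤ m * 4 ^ (n * (k + 1)) * k ^ (k * 4 ^ n - 1) := by
  classical
  let r := Fintype.equivFin (ET S A)
  let M : {e : ET S A // r e < r (esym e)} → NT S A → ℤ :=
    fun e t => (cnt t e.1 : ℤ) - cnt t (esym e.1)
  have hcnt : ∀ t : NT S A, ∑ e, cnt t e ≤ k := by
    intro t
    have h1 : ∑ e : ET S A, cnt t e = ∑ d : S.D, ∑ p, cnt t (d, p) :=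
      Fintype.sum_prod_type _
    have h2 : ∀ d : S.D, ∑ p, cnt t (d, p) ≤ 1 := by
      intro d
      calc ∑ p, cnt t (d, p) ≤ ∑ p, (if t.2 d = p then 1 else 0) := by
            apply Finset.sum_le_sum
            intro p _
            simp only [cnt]
            split_ifs <;> simp_all
        _ = 1 := by simp
    rw [h1]
    calc ∑ d : S.D, ∑ p, cnt t (d, p) ≤ ∑ _d : S.D, 1 := Finset.sum_le_sum fun d _ => h2 d
      _ = k := by simp [hk]
  have hcol : ∀ t, ∑ e, |M e t| ≤ (k : ℤ) := by
    intro t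
    have h1 : ∑ e, |M e t| ≤ ∑ e : {e : ET S A // r e < r (esym e)},
        ((cnt t e.1 + cnt t (esym e.1) : ℕ) : ℤ) := by
      apply Finset.sum_le_sum
      intro e _
      simp only [M]
      rw [abs_le]
      constructor <;> push_cast <;> linarith [Int.natCast_nonneg (cnt t e.1),
        Int.natCast_nonneg (cnt t (esym e.1))]
    have h2 := (sum_bound_aux r esym esym_esym (cnt t)).trans (hcnt t)
    refine h1.trans ?_
    exact_mod_cast h2
  set R := Fintype.card {e : ET S A // r e < r (esym e)} with hR
  have hET : Fintype.card (ET S A) = k * 4 ^ n := by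
    simp [ET, hk, hn, ← mul_pow]
  have hNT : Fintype.card (NT S A) = m * 4 ^ (n * k) := by
    simp [NT, hk, hn, hm, ← mul_pow, pow_mul]
  have hRK : 2 * R ≤ k * 4 ^ n := by
    have h := sum_bound_aux r esym esym_esym (fun _ => 1)
    simp only [Finset.sum_const, Finset.card_univ, smul_eq_mul, mul_one] at h
    have h' := h.trans hET.le
    omega
  have hMs : ∀ (y : NT S A → ℕ) e, ∑ t, M e t * (y t : ℤ) =
      ((∑ t, y t * cnt t e.1 : ℕ) : ℤ) - ((∑ t, y t * cnt t (esym e.1) : ℕ) : ℤ) := by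
    intro y e
    push_cast
    rw [← Finset.sum_sub_distrib]
    exact Finset.sum_congr rfl fun t _ => by simp only [M]; ring
  have hbal_iff : ∀ y : NT S A → ℕ, (∀ e, ∑ t, M e t * (y t : ℤ) = 0) ↔
      ∀ e : ET S A, ∑ t, y t * cnt t e = ∑ t, y t * cnt t (esym e) := by
    intro y
    constructor
    · intro h e
      rcases lt_trichotomy (r e) (r (esym e)) with h' | h' | h'
      · have := h ⟨e, h'⟩
        rw [hMs] at this
        simp only at this
        omega
      · rw [← r.injective h']
      · have := h ⟨esym e, by rwa [esym_esym]⟩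
        rw [hMs] at this
        simp only [esym_esym] at this
        omega
    · intro h e
      rw [hMs, h e.1, sub_self]
  let P : (NT S A → ℕ) → Prop := fun g => (∀ t, g t ≠ 0 → NOK t) ∧
      (∀ e, ∑ t, M e t * (g t : ℤ) = 0) ∧
      ∑ t : NT S A, g t * (if t.1 ∈ S.init then 1 else 0) = 1
  have hex : ∃ N, ∃ g, P g ∧ ∑ t, g t = N := by
    obtain ⟨G, hG⟩ := hacc
    obtain ⟨g, h1, h2, h3⟩ := counts G hG
    exact ⟨_, g, ⟨h1, (hbal_iff g).2 h2, h3⟩, rfl⟩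
  obtain ⟨x, hxP, hxN⟩ := Nat.find_spec hex
  have hmin : ∀ g, P g → ∑ t, x t ≤ ∑ t, g t := by
    intro g hg
    rw [hxN]
    exact Nat.find_min' hex ⟨g, hg, rfl⟩
  obtain ⟨hx1, hx2, hx3⟩ := hxP
  have hind : ∀ y : NT S A → ℕ, y ≤ x → (∀ e, ∑ t, M e t * (y t : ℤ) = 0) → y ≠ 0 → y = x := by
    intro y hyx hy hy0
    have hok : ∀ z : NT S A → ℕ, z ≤ x → ∀ t, z t ≠ 0 → NOK t := by
      intro z hz t ht
      apply hx1
      have : z t ≤ x t := hz t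
      omega
    let z : NT S A → ℕ := fun t => x t - y t
    have hzx : ∀ t, x t = y t + z t := fun t => by have : y t ≤ x t := hyx t; simp only [z]; omega
    have hz : ∀ e, ∑ t, M e t * (z t : ℤ) = 0 := by
      intro e
      have h1 := hx2 e
      simp only [hzx, Nat.cast_add, mul_add, Finset.sum_add_distrib, hy e, zero_add] at h1
      exact h1
    have hsum : ∑ t, x t = ∑ t, y t + ∑ t, z t := by
      rw [← Finset.sum_add_distrib]
      exact Finset.sum_congr rfl fun t _ => hzx t
    have hin : ∑ t : NT S A, y t * (if t.1 ∈ S.init then 1 else 0) +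
        ∑ t : NT S A, z t * (if t.1 ∈ S.init then 1 else 0) = 1 := by
      rw [← Finset.sum_add_distrib]
      refine Eq.trans ?_ hx3
      exact Finset.sum_congr rfl fun t _ => by rw [hzx t]; ring
    have hzle : z ≤ x := fun t => Nat.sub_le _ _
    rcases Nat.eq_zero_or_pos (∑ t : NT S A, y t * (if t.1 ∈ S.init then 1 else 0)) with h | h
    · have := hmin z ⟨hok z hzle, hz, by omega⟩
      have h0 : ∑ t, y t = 0 := by omega
      exfalso
      apply hy0
      funext t
      exact Finset.sum_eq_zero_iff.1 h0 t (Finset.mem_univ t)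
    · have := hmin y ⟨hok y hyx, hy, by omega⟩
      have h0 : ∑ t, z t = 0 := by omega
      funext t
      have := Finset.sum_eq_zero_iff.1 h0 t (Finset.mem_univ t)
      rw [hzx t, this, add_zero]
  have hbound := indec_bound M k (by omega) hcol x hx2 hind
  obtain ⟨G, hG, hGn⟩ := build x hx1 ((hbal_iff x).1 hx2) hx3
  refine ⟨G, hG, ?_⟩
  rw [hGn]
  refine hbound.trans ?_
  rw [hNT, ← hR]
  have hk2 : 2 ≤ k := by omega
  have hn1 : 1 ≤ n := by
    rw [← hn]
    exact Fintype.card_pos_iff.2 ⟨A.q0⟩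
  have h4 : 4 ≤ 4 ^ n := by
    calc 4 = 4 ^ 1 := by norm_num
      _ ≤ 4 ^ n := Nat.pow_le_pow_right (by norm_num) hn1
  have hK : 8 ≤ k * 4 ^ n := by nlinarith
  have e1 : (R + 1) * k ^ R ≤ 4 ^ n * k ^ (k * 4 ^ n - 1) := by
    calc (R + 1) * k ^ R ≤ (k * 4 ^ n) * k ^ R := Nat.mul_le_mul_right _ (by omega)
      _ = 4 ^ n * k ^ (R + 1) := by ring
      _ ≤ 4 ^ n * k ^ (k * 4 ^ n - 1) :=
        Nat.mul_le_mul_left _ (Nat.pow_le_pow_right (by omega) (by omega))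
  calc m * 4 ^ (n * k) * ((R + 1) * k ^ R)
      ≤ m * 4 ^ (n * k) * (4 ^ n * k ^ (k * 4 ^ n - 1)) := Nat.mul_le_mul_left _ e1
    _ = m * 4 ^ (n * (k + 1)) * k ^ (k * 4 ^ n - 1) := by
      rw [mul_add, mul_one, pow_add]; ring
end
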